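/- Let q = 2^e ≥ 4 and G = SL(2,q). Let F be an algebraically closed field of characteristic r > 0 and M a finite-dimensional irreducible FG-module. Then: (i) if r ≠ 2, then (q-1)·dim H^2(G,M) ≤ dim M; (ii) if r = 2, then 2·dim H^2(G,M) ≤ dim M, unless q = 4 and M is the one-dimensional module with trivial G-action. -/

import Mathlib

namespace Representation

variable {F G M : Type} [Field F] [Group G] [AddCommGroup M] [Module F M]

/-- Inhomogeneous `2`-cocycles with values in a representation. -/
def IsTwoCocycle (ρ : Representation F G M) (f : G → G → M) : Prop :=
  ∀ g h j, f (g * h) j + f g h = ρ g (f h j) + f g (h * j)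

/-- The restriction of `f` to the subgroup `H` is a `2`-coboundary. -/
def IsTwoCoboundaryOn (ρ : Representation F G M) (H : Subgroup G) (f : G → G → M) : Prop :=
  ∃ α : G → M, ∀ g ∈ H, ∀ h ∈ H, f g h = ρ g (α h) - α (g * h) + α g

theorem IsTwoCocycle.add {ρ : Representation F G M} {f₁ f₂ : G → G → M}
    (h₁ : ρ.IsTwoCocycle f₁) (h₂ : ρ.IsTwoCocycle f₂) : ρ.IsTwoCocycle (f₁ + f₂) := by
  intro g h j
  have e₁ := h₁ g h j
  have e₂ := h₂ g h j
  simp only [Pi.add_apply, map_add]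
  linear_combination (norm := module) e₁ + e₂

theorem IsTwoCocycle.smul {ρ : Representation F G M} {f : G → G → M} (a : F)
    (hf : ρ.IsTwoCocycle f) : ρ.IsTwoCocycle (a • f) := by
  intro g h j
  simp only [Pi.smul_apply, map_smul, ← smul_add, hf g h j]

theorem isTwoCocycle_coboundary (ρ : Representation F G M) (α : G → M) :
    ρ.IsTwoCocycle fun g h => ρ g (α h) - α (g * h) + α g := by
  intro g h j
  simp only [map_add, map_sub, map_mul, Module.End.mul_apply, mul_assoc]
  abel

theorem IsTwoCocycle.neg {ρ : Representation F G M} {f : G → G → M}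
    (hf : ρ.IsTwoCocycle f) : ρ.IsTwoCocycle (-f) := by
  simpa using hf.smul (-1)

theorem IsTwoCocycle.sub {ρ : Representation F G M} {f₁ f₂ : G → G → M}
    (h₁ : ρ.IsTwoCocycle f₁) (h₂ : ρ.IsTwoCocycle f₂) : ρ.IsTwoCocycle (f₁ - f₂) := by
  simpa [sub_eq_add_neg] using h₁.add h₂.neg

open groupCohomology in
theorem finrank_H2_le_one_of_dependent (ρ : Representation F G M)
    (h : ∀ f₁ f₂ : G → G → M, ρ.IsTwoCocycle f₁ → ρ.IsTwoCocycle f₂ →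
      ∃ a b : F, (a ≠ 0 ∨ b ≠ 0) ∧ ρ.IsTwoCoboundaryOn ⊤ (a • f₁ + b • f₂)) :
    Module.finrank F (groupCohomology (Rep.of ρ) 2) ≤ 1 := by
  have key : ∀ x y : groupCohomology (Rep.of ρ) 2,
      ∃ a b : F, (a ≠ 0 ∨ b ≠ 0) ∧ a • x + b • y = 0 := by
    intro x y
    induction x using H2_induction_on with | _ x =>
    induction y using H2_induction_on with | _ y =>
    obtain ⟨a, b, hab, α, hα⟩ := h (fun g h => x (g, h)) (fun g h => y (g, h))
      ((mem_cocycles₂_iff (A := Rep.of ρ) x).1 x.2) ((mem_cocycles₂_iff (A := Rep.of ρ) y).1 y.2)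
    refine ⟨a, b, hab, ?_⟩
    have := (H2π_eq_zero_iff (A := Rep.of ρ) (a • x + b • y)).2
      ⟨α, by ext ⟨g, k⟩; exact (hα g (Subgroup.mem_top _) k (Subgroup.mem_top _)).symm⟩
    simpa using this
  by_cases h0 : ∀ x : groupCohomology (Rep.of ρ) 2, x = 0
  · have : Subsingleton (groupCohomology (Rep.of ρ) 2) := ⟨fun x y => by rw [h0 x, h0 y]⟩
    exact (Module.finrank_zero_of_subsingleton).le.trans zero_le_one
  · push Not at h0
    obtain ⟨x, hx⟩ := h0
    refine finrank_le_one x fun y => ?_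
    obtain ⟨a, b, hab, e⟩ := key x y
    have hb : b ≠ 0 := by
      rintro rfl
      simp_all
    refine ⟨-(b⁻¹ * a), ?_⟩
    rw [neg_smul, neg_eq_iff_add_eq_zero]
    have := congrArg (fun z => b⁻¹ • z) e
    simpa [smul_smul, hb] using this

open groupCohomology in
theorem finrank_H2_eq_zero_of_coboundary (ρ : Representation F G M)
    (h : ∀ f : G → G → M, ρ.IsTwoCocycle f → ρ.IsTwoCoboundaryOn ⊤ f) :
    Module.finrank F (groupCohomology (Rep.of ρ) 2) = 0 := by
  have key : ∀ x : groupCohomology (Rep.of ρ) 2, x = 0 := by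
    intro x
    induction x using H2_induction_on with | _ x =>
    obtain ⟨α, hα⟩ := h (fun g h => x (g, h)) ((mem_cocycles₂_iff (A := Rep.of ρ) x).1 x.2)
    exact (H2π_eq_zero_iff (A := Rep.of ρ) x).2
      ⟨α, by ext ⟨g, k⟩; exact (hα g (Subgroup.mem_top _) k (Subgroup.mem_top _)).symm⟩
  have : Subsingleton (groupCohomology (Rep.of ρ) 2) := ⟨fun x y => by rw [key x, key y]⟩
  exact Module.finrank_zero_of_subsingleton

/-- Conjugation acts trivially on cohomology. -/
theorem IsTwoCocycle.conj_sub {ρ : Representation F G M} {f : G → G → M}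
    (hf : ρ.IsTwoCocycle f) (t : G) : ∃ α : G → M, ∀ g h,
      ρ t (f (t⁻¹ * g * t) (t⁻¹ * h * t)) - f g h = ρ g (α h) - α (g * h) + α g := by
  refine ⟨fun g => f t (t⁻¹ * g * t) - f g t, fun g h => ?_⟩
  have e₁ := hf t (t⁻¹ * g * t) (t⁻¹ * h * t)
  have e₂ := hf g t (t⁻¹ * h * t)
  have e₃ := hf g h t
  have a₁ : t * (t⁻¹ * g * t) = g * t := by group
  have a₂ : t⁻¹ * g * t * (t⁻¹ * h * t) = t⁻¹ * (g * h) * t := by group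
  have a₃ : t * (t⁻¹ * h * t) = h * t := by group
  rw [a₁, a₂] at e₁
  rw [a₃] at e₂
  rw [map_sub]
  linear_combination (norm := module) e₂ - e₁ - e₃

/-- A `2`-cocycle which is a coboundary on a subgroup of invertible index is a coboundary. -/
theorem IsTwoCocycle.isTwoCoboundaryOn_top [Finite G] {ρ : Representation F G M} {f : G → G → M}
    (hf : ρ.IsTwoCocycle f) (H : Subgroup G) (hH : (H.index : F) ≠ 0)
    (hr : ρ.IsTwoCoboundaryOn H f) : ρ.IsTwoCoboundaryOn ⊤ f := by
  classical
  -- it suffices to treat cocycles vanishing on `H × G`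
  have main : ∀ f : G → G → M, ρ.IsTwoCocycle f → (∀ c ∈ H, ∀ x, f c x = 0) →
      ρ.IsTwoCoboundaryOn ⊤ f := by
    intro f hf h0
    let φ : G → G → M := fun g x => ρ x (f x⁻¹ g)
    have hφ : ∀ g x c, c ∈ H → φ g (x * c) = φ g x := by
      intro g x c hc
      have e := hf c⁻¹ x⁻¹ g
      rw [h0 _ (H.inv_mem hc), h0 _ (H.inv_mem hc), add_zero, add_zero] at e
      simp only [φ, mul_inv_rev, e, ← Module.End.mul_apply, ← map_mul]
      group
    let Φ : G → G ⧸ H → M := fun g => Quotient.lift (φ g) (by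
      intro a b hab
      have := hφ g a _ (QuotientGroup.leftRel_apply.1 hab)
      simpa using this.symm)
    have : Fintype (G ⧸ H) := Fintype.ofFinite _
    refine ⟨fun g => (H.index : F)⁻¹ • ∑ q, Φ g q, fun g _ h _ => ?_⟩
    have key : ∀ q : G ⧸ H, ρ g (Φ h q) = f g h + Φ (g * h) (g • q) - Φ g (g • q) := by
      intro q
      induction q using QuotientGroup.induction_on with | H x =>
      change ρ g (ρ x (f x⁻¹ h)) = f g h + ρ (g * x) (f (g * x)⁻¹ (g * h)) -
        ρ (g * x) (f (g * x)⁻¹ g)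
      have e := hf (x⁻¹ * g⁻¹) g h
      have e' := congrArg (ρ (g * x)) e
      simp only [map_add, ← Module.End.mul_apply, ← map_mul, mul_inv_rev] at e' ⊢
      simp only [mul_assoc, inv_mul_cancel, mul_one, mul_inv_cancel, mul_inv_cancel_left, map_one,
        Module.End.one_apply] at e' ⊢
      linear_combination (norm := module) e'
    have s₁ : ∀ k, ∑ q : G ⧸ H, Φ k (g • q) = ∑ q, Φ k q := fun k =>
      Equiv.sum_comp (MulAction.toPerm g) (Φ k)
    have hc : (Fintype.card (G ⧸ H) : F) = H.index := by
      rw [Subgroup.index, Nat.card_eq_fintype_card]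
    rw [map_smul, map_sum, Finset.sum_congr rfl fun q _ => key q, Finset.sum_sub_distrib,
      Finset.sum_add_distrib, s₁, s₁, Finset.sum_const, Finset.card_univ, ← Nat.cast_smul_eq_nsmul F,
      hc, smul_sub, smul_add, smul_smul, inv_mul_cancel₀ hH, one_smul]
    abel
  obtain ⟨α, hα⟩ := hr
  -- kill the restriction to `H × H`
  set f₁ : G → G → M := fun g h => f g h - (ρ g (α h) - α (g * h) + α g) with hf₁
  have c₁ : ρ.IsTwoCocycle f₁ := hf.sub (isTwoCocycle_coboundary ρ α)
  have v₁ : ∀ c ∈ H, ∀ d ∈ H, f₁ c d = 0 := fun c hc d hd => sub_eq_zero.2 (hα c hc d hd)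
  -- choose representatives of the right cosets of `H`
  let s : G → G := fun x => (Quotient.mk (QuotientGroup.rightRel H) x).out
  have hs : ∀ x, x * (s x)⁻¹ ∈ H := fun x =>
    QuotientGroup.rightRel_apply.1 (Quotient.mk_out (s := QuotientGroup.rightRel H) x)
  have hs' : ∀ c ∈ H, ∀ x, s (c * x) = s x := by
    intro c hc x
    have : (Quotient.mk (QuotientGroup.rightRel H) (c * x)) =
        Quotient.mk (QuotientGroup.rightRel H) x :=
      Quotient.sound (QuotientGroup.rightRel_apply.2 (by simpa using hc))
    simp only [s, this]
  let β : G → M := fun x => -f₁ (x * (s x)⁻¹) (s x)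
  have c₂ := c₁.sub (isTwoCocycle_coboundary ρ β)
  obtain ⟨γ, hγ⟩ := main _ c₂ (by
    intro c hc x
    have e := c₁ c (x * (s x)⁻¹) (s x)
    have hβ : β c = 0 := by
      have h1 : s c ∈ H := by
        have := H.mul_mem (H.inv_mem (hs c)) hc
        simpa using this
      simp only [β, neg_eq_zero]
      exact v₁ _ (hs c) _ h1
    rw [v₁ c hc _ (hs x), add_zero] at e
    have h2 : x * (s x)⁻¹ * s x = x := by group
    rw [h2] at e
    simp only [Pi.sub_apply, hβ]
    simp only [β, hs' c hc, map_neg, mul_assoc c] at e ⊢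
    rw [e]
    abel)
  refine ⟨α + β + γ, fun g _ h _ => ?_⟩
  have e := hγ g (Subgroup.mem_top _) h (Subgroup.mem_top _)
  simp only [Pi.sub_apply, hf₁] at e
  simp only [Pi.add_apply, map_add]
  linear_combination (norm := module) e

end Representation

namespace Representation

variable {F G M : Type} [Field F] [Group G] [AddCommGroup M] [Module F M]

/-- The sum of the operators attached to the elements of a subgroup. -/
noncomputable def subgroupNorm [Finite G] (ρ : Representation F G M) (C : Subgroup G) :
    M →ₗ[F] M :=
  letI := Fintype.ofFinite C
  ∑ x : C, ρ x

/-- The invariant of the restriction of a `2`-cocycle to the cyclic group generated by `c`. -/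
noncomputable def cyclicSum [Finite G] (f : G → G → M) (c : G) : M :=
  letI := Fintype.ofFinite (Subgroup.zpowers c)
  ∑ x : Subgroup.zpowers c, f x c

variable {ρ : Representation F G M}

theorem sum_zpowers_mul {c : G} [Fintype (Subgroup.zpowers c)] (φ : G → M) :
    ∑ x : Subgroup.zpowers c, φ (c * x) = ∑ x : Subgroup.zpowers c, φ x :=
  Equiv.sum_comp (Equiv.mulLeft (⟨c, Subgroup.mem_zpowers c⟩ : Subgroup.zpowers c))
    (fun x => φ x)

theorem sum_zpowers_mul' {c : G} [Fintype (Subgroup.zpowers c)] (φ : G → M) :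
    ∑ x : Subgroup.zpowers c, φ (x * c) = ∑ x : Subgroup.zpowers c, φ x :=
  Equiv.sum_comp (Equiv.mulRight (⟨c, Subgroup.mem_zpowers c⟩ : Subgroup.zpowers c))
    (fun x => φ x)

theorem IsTwoCocycle.map_one_right {f : G → G → M} (hf : ρ.IsTwoCocycle f) (g : G) :
    f g 1 = ρ g (f 1 1) := by
  have := hf g 1 1
  simpa using this

variable [Finite G]

theorem subgroupNorm_apply (C : Subgroup G) [Fintype C] (m : M) :
    ρ.subgroupNorm C m = ∑ x : C, ρ x m := by
  rw [subgroupNorm, LinearMap.sum_apply]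
  congr!

theorem cyclicSum_eq (f : G → G → M) (c : G) [Fintype (Subgroup.zpowers c)] :
    cyclicSum f c = ∑ x : Subgroup.zpowers c, f x c := by
  rw [cyclicSum]
  congr!

theorem sum_zpowers_eq_sum_range {c : G} [Fintype (Subgroup.zpowers c)] (φ : G → M) :
    ∑ x : Subgroup.zpowers c, φ x = ∑ i ∈ Finset.range (orderOf c), φ (c ^ i) := by
  rw [← Fin.sum_univ_eq_sum_range (fun i => φ (c ^ i)), ← Equiv.sum_comp (finEquivZPowers
    (isOfFinOrder_of_finite c))]
  rfl

theorem IsTwoCocycle.map_cyclicSum {f : G → G → M} (hf : ρ.IsTwoCocycle f) (c : G) :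
    ρ c (cyclicSum f c) = cyclicSum f c := by
  have := Fintype.ofFinite (Subgroup.zpowers c)
  simp only [cyclicSum_eq, map_sum]
  have h : ∀ x : G, ρ c (f x c) = f (c * x) c + f c x - f c (x * c) := fun x => by
    rw [hf c x c]
    abel
  simp only [h, Finset.sum_sub_distrib, Finset.sum_add_distrib]
  rw [sum_zpowers_mul (fun x => f x c), sum_zpowers_mul' (fun x => f c x)]
  abel

theorem cyclicSum_eq_of_coboundary {f : G → G → M} {c : G} {α : G → M}
    (h : ∀ g h, f g h = ρ g (α h) - α (g * h) + α g) :
    cyclicSum f c = ρ.subgroupNorm (Subgroup.zpowers c) (α c) := by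
  have := Fintype.ofFinite (Subgroup.zpowers c)
  rw [subgroupNorm_apply, cyclicSum_eq]
  simp only [h, Finset.sum_sub_distrib, Finset.sum_add_distrib]
  rw [sum_zpowers_mul' (fun x => α x)]
  simp only [sub_add_cancel]

theorem IsTwoCocycle.sum_inv {f : G → G → M} (hf : ρ.IsTwoCocycle f) (c : G)
    [Fintype (Subgroup.zpowers c)] :
    ∑ x : Subgroup.zpowers c, f x c⁻¹ + cyclicSum f c =
      ρ.subgroupNorm (Subgroup.zpowers c) (f c c⁻¹ + f 1 1) := by
  have h : ∀ x : G, f (x * c) c⁻¹ + f x c = ρ x (f c c⁻¹ + f 1 1) := fun x => by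
    rw [hf x c c⁻¹, mul_inv_cancel, hf.map_one_right x, map_add]
  rw [subgroupNorm_apply, cyclicSum_eq, ← sum_zpowers_mul' (fun x => f x c⁻¹)]
  simp only [← h, Finset.sum_add_distrib]

theorem IsTwoCocycle.isTwoCoboundaryOn_zpowers {f : G → G → M} (hf : ρ.IsTwoCocycle f) {c : G}
    (h : cyclicSum f c ∈ LinearMap.range (ρ.subgroupNorm (Subgroup.zpowers c))) :
    ρ.IsTwoCoboundaryOn (Subgroup.zpowers c) f := by
  classical
  have := Fintype.ofFinite (Subgroup.zpowers c)
  obtain ⟨m, hm⟩ := h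
  let α : ℕ → M := fun k => f 1 1 + ∑ i ∈ Finset.range k, (ρ (c ^ i) m - f (c ^ i) c)
  have hα : ∀ k, α (k + 1) = α k + ρ (c ^ k) m - f (c ^ k) c := fun k => by
    simp only [α, Finset.sum_range_succ]
    abel
  have hα0 : α 0 = f 1 1 := by simp [α]
  have hper : Function.Periodic α (orderOf c) := by
    intro k
    induction k with
    | zero =>
      rw [subgroupNorm_apply, sum_zpowers_eq_sum_range (fun x => ρ x m)] at hm
      have h2 : cyclicSum f c = ∑ i ∈ Finset.range (orderOf c), f (c ^ i) c := by
        rw [cyclicSum_eq, ← sum_zpowers_eq_sum_range (fun x => f x c)]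
      simp only [α, zero_add, Finset.sum_sub_distrib, ← h2, hm]
      simp
    | succ k ih =>
      rw [show k + 1 + orderOf c = k + orderOf c + 1 by ring, hα, hα, ih, pow_add,
        pow_orderOf_eq_one, mul_one]
  clear_value α
  have hcongr : ∀ k l, c ^ k = c ^ l → α k = α l := by
    intro k l hkl
    rw [pow_eq_pow_iff_modEq] at hkl
    rw [← hper.map_mod_nat k, ← hper.map_mod_nat l, hkl]
  have key : ∀ k l, f (c ^ k) (c ^ l) = ρ (c ^ k) (α l) - α (k + l) + α k := by
    intro k l
    induction l with
    | zero => simp [hf.map_one_right (c ^ k), hα0]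
    | succ l ih =>
      have e := hf (c ^ k) (c ^ l) c
      rw [← pow_add, ← pow_succ, ih] at e
      have hp : ρ (c ^ (k + l)) m = ρ (c ^ k) (ρ (c ^ l) m) := by
        rw [pow_add, map_mul]
        rfl
      rw [hα, ← add_assoc, hα, map_sub, map_add, hp]
      linear_combination (norm := module) -e
  let β : G → M := fun g => if h : ∃ k : ℕ, c ^ k = g then α h.choose else 0
  have hβ : ∀ k, β (c ^ k) = α k := by
    intro k
    have h : ∃ l : ℕ, c ^ l = c ^ k := ⟨k, rfl⟩
    simp only [β, dif_pos h]
    exact hcongr _ _ h.choose_spec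
  refine ⟨β, fun g hg h hh => ?_⟩
  obtain ⟨k, rfl⟩ := (isOfFinOrder_of_finite c).mem_powers_iff_mem_zpowers.2 hg
  obtain ⟨l, rfl⟩ := (isOfFinOrder_of_finite c).mem_powers_iff_mem_zpowers.2 hh
  simp only [← pow_add, hβ, key]

/-- If `z` inverts `c`, then `z` acts as `-1` on the invariant of a cocycle of the whole group. -/
theorem IsTwoCocycle.cyclicSum_add_map_mem {f : G → G → M} (hf : ρ.IsTwoCocycle f) {c z : G}
    (hz : z * c * z⁻¹ = c⁻¹) :
    cyclicSum f c + ρ z (cyclicSum f c) ∈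
      LinearMap.range (ρ.subgroupNorm (Subgroup.zpowers c)) := by
  have := Fintype.ofFinite (Subgroup.zpowers c)
  obtain ⟨α, hα⟩ := hf.conj_sub z⁻¹
  have e₁ := cyclicSum_eq_of_coboundary (f := fun g h => ρ z⁻¹ (f (z⁻¹⁻¹ * g * z⁻¹)
    (z⁻¹⁻¹ * h * z⁻¹)) - f g h) (c := c) hα
  have e₂ := hf.sum_inv c
  have e₃ : cyclicSum (fun g h => ρ z⁻¹ (f (z⁻¹⁻¹ * g * z⁻¹) (z⁻¹⁻¹ * h * z⁻¹)) - f g h) c =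
      ρ z⁻¹ (∑ x : Subgroup.zpowers c, f x c⁻¹) - cyclicSum f c := by
    simp only [cyclicSum_eq, inv_inv, hz, Finset.sum_sub_distrib, map_sum]
    have hx : ∀ x : Subgroup.zpowers c, z * x * z⁻¹ = (x⁻¹ : Subgroup.zpowers c) := by
      rintro ⟨_, k, rfl⟩
      simp only [← conj_zpow, hz, InvMemClass.coe_inv, inv_zpow]
    simp only [hx]
    rw [← Equiv.sum_comp (Equiv.inv (Subgroup.zpowers c)) (fun x => ρ z⁻¹ (f x c⁻¹))]
    rfl
  have hcomm : ∀ m, ρ z (ρ.subgroupNorm (Subgroup.zpowers c) m) =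
      ρ.subgroupNorm (Subgroup.zpowers c) (ρ z m) := by
    intro m
    simp only [subgroupNorm_apply, map_sum]
    rw [← Equiv.sum_comp (Equiv.inv (Subgroup.zpowers c))]
    refine Finset.sum_congr rfl fun x _ => ?_
    have : z * (x⁻¹ : Subgroup.zpowers c) = x * z := by
      obtain ⟨_, k, rfl⟩ := x
      have : z * c⁻¹ * z⁻¹ = c := by rw [← inv_inj, ← conj_inv, inv_inv, hz]
      rw [← mul_inv_eq_iff_eq_mul]
      simp only [InvMemClass.coe_inv, ← zpow_neg, ← inv_zpow', ← conj_zpow, this]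
    rw [← Module.End.mul_apply, ← map_mul, ← Module.End.mul_apply, ← map_mul]
    exact congrArg (fun y => ρ y m) this
  have e₄ : ρ z (ρ z⁻¹ (∑ x : Subgroup.zpowers c, f x c⁻¹)) =
      ∑ x : Subgroup.zpowers c, f x c⁻¹ := by
    rw [← Module.End.mul_apply, ← map_mul]
    simp
  rw [e₃] at e₁
  have e₅ := congrArg (ρ z) e₁
  rw [map_sub, e₄, hcomm] at e₅
  refine ⟨f c c⁻¹ + f 1 1 - ρ z (α c), ?_⟩
  rw [map_sub]
  linear_combination (norm := module) e₅ - e₂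

end Representation

namespace Representation

theorem exists_commute_of_mem_ker {F M : Type*} [Field F] [AddCommGroup M] [Module F M]
    [FiniteDimensional F M] (x : Module.End F M) {W : Submodule F M}
    (hW : ∀ v ∈ W, x v = 0) (hW2 : 2 ≤ Module.finrank F W) :
    ∃ f : Module.End F M, Commute f x ∧ ∃ u ∈ W, ∃ w ∈ W, u ≠ 0 ∧ w ≠ 0 ∧ f u = u ∧ f w = 0 := by
  classical
  have hex : ∃ k, W ⊓ LinearMap.range (x ^ (k + 1)) = ⊥ := by
    obtain ⟨n, hn⟩ := (x.eventually_disjoint_ker_pow_range_pow).exists_forall_of_atTop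
    refine ⟨n, ?_⟩
    rw [← disjoint_iff]
    refine (hn (n + 1) (Nat.le_succ n)).mono_left fun v hv => ?_
    rw [LinearMap.mem_ker, pow_succ, Module.End.mul_apply, hW v hv, map_zero]
  set k := Nat.find hex
  have hk : W ⊓ LinearMap.range (x ^ (k + 1)) = ⊥ := Nat.find_spec hex
  have hk' : W ⊓ LinearMap.range (x ^ k) ≠ ⊥ := by
    rcases Nat.eq_zero_or_pos k with h0 | h0
    · rw [h0, pow_zero]
      intro h
      have : W = ⊥ := by simpa [Module.End.one_eq_id] using h
      rw [this, finrank_bot] at hW2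
      omega
    · have := Nat.find_min hex (m := k - 1) (by omega)
      rwa [Nat.sub_add_cancel h0] at this
  obtain ⟨u, ⟨huW, u₀, rfl⟩, hu0⟩ := Submodule.exists_mem_ne_zero_of_ne_bot hk'
  set u := (x ^ k) u₀ with hu
  obtain ⟨w, hwW, hw⟩ : ∃ w ∈ W, w ∉ Submodule.span F {u} := by
    by_contra! h
    have := Submodule.finrank_mono (show W ≤ Submodule.span F {u} from h)
    rw [finrank_span_singleton hu0] at this
    omega
  have hunot : u ∉ LinearMap.range (x ^ (k + 1)) ⊔ Submodule.span F {w} := by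
    intro h
    obtain ⟨r, hr, s, hs, hrs⟩ := Submodule.mem_sup.1 h
    obtain ⟨a, rfl⟩ := Submodule.mem_span_singleton.1 hs
    have hr' : r ∈ W ⊓ LinearMap.range (x ^ (k + 1)) := by
      refine ⟨?_, hr⟩
      rw [show r = u - a • w by rw [← hrs]; abel]
      exact W.sub_mem huW (W.smul_mem a hwW)
    rw [hk, Submodule.mem_bot] at hr'
    rw [hr', zero_add] at hrs
    apply hw
    rw [Submodule.mem_span_singleton]
    have ha : a ≠ 0 := by
      rintro rfl
      exact hu0 (by rw [← hrs, zero_smul])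
    exact ⟨a⁻¹, by rw [← hrs, inv_smul_smul₀ ha]⟩
  obtain ⟨l, hlu, hl⟩ := Submodule.exists_dual_map_eq_bot_of_notMem hunot inferInstance
  have hl0 : ∀ v ∈ LinearMap.range (x ^ (k + 1)) ⊔ Submodule.span F {w}, l v = 0 := fun v hv =>
    (Submodule.mem_bot F).1 (hl ▸ Submodule.mem_map_of_mem hv)
  let f : Module.End F M :=
    (l u)⁻¹ • ∑ i ∈ Finset.range (k + 1), (l ∘ₗ x ^ (k - i)).smulRight ((x ^ i) u₀)
  have hf : ∀ m, f m = (l u)⁻¹ • ∑ i ∈ Finset.range (k + 1), l ((x ^ (k - i)) m) • (x ^ i) u₀ :=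
    fun m => by simp [f]
  have hfW : ∀ v ∈ W, f v = (l u)⁻¹ • l v • u := by
    intro v hv
    rw [hf, Finset.sum_range_succ, Finset.sum_eq_zero, zero_add, Nat.sub_self, pow_zero]
    · rfl
    · intro i hi
      rw [Finset.mem_range] at hi
      obtain ⟨j, hj⟩ : ∃ j, k - i = j + 1 := ⟨k - i - 1, by omega⟩
      rw [hj, pow_succ, Module.End.mul_apply, hW v hv, map_zero, map_zero, zero_smul]
  refine ⟨f, ?_, u, huW, w, hwW, hu0, fun h => hw (by rw [h]; exact zero_mem _), ?_, ?_⟩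
  · refine LinearMap.ext fun m => ?_
    rw [Module.End.mul_apply, Module.End.mul_apply, hf, hf, map_smul, map_sum]
    congr 1
    have e := Finset.sum_range_succ (fun i => l ((x ^ (k + 1 - i)) m) • (x ^ i) u₀) (k + 1)
    rw [Finset.sum_range_succ'] at e
    simp only [Nat.sub_zero, pow_zero, Nat.sub_self, Nat.add_sub_add_right] at e
    have e1 : l ((x ^ (k + 1)) m) = 0 :=
      hl0 _ (Submodule.mem_sup_left (LinearMap.mem_range_self _ _))
    have e2 : (x ^ (k + 1)) u₀ = 0 := by
      rw [pow_succ', Module.End.mul_apply]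
      exact hW _ huW
    rw [e1, e2, zero_smul, smul_zero, add_zero, add_zero] at e
    have e3 : ∑ i ∈ Finset.range (k + 1), l ((x ^ (k - i)) (x m)) • (x ^ i) u₀ =
        ∑ i ∈ Finset.range (k + 1), l ((x ^ (k + 1 - i)) m) • (x ^ i) u₀ := by
      refine Finset.sum_congr rfl fun i hi => ?_
      rw [Finset.mem_range] at hi
      rw [show k + 1 - i = k - i + 1 by omega, pow_succ, Module.End.mul_apply]
    rw [e3, ← e]
    refine Finset.sum_congr rfl fun i hi => ?_
    rw [map_smul, pow_succ', Module.End.mul_apply]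
  · rw [hfW u huW, smul_smul, inv_mul_cancel₀ hlu, one_smul]
  · rw [hfW w hwW, hl0 w (Submodule.mem_sup_right (Submodule.mem_span_singleton_self w)),
      zero_smul, smul_zero]

variable {F G M : Type} [Field F] [Group G] [AddCommGroup M] [Module F M]
variable {ρ : Representation F G M} [Finite G]

theorem sum_mem_range_subgroupNorm {α : Type*} [MulAction G α] {C : Subgroup G} {ψ : α → M}
    (hψ : ∀ c ∈ C, ∀ s, ψ (c • s) = ρ c (ψ s)) (S : Finset α)
    (hS : ∀ c ∈ C, ∀ s ∈ S, c • s ∈ S) (hfree : ∀ c ∈ C, ∀ s ∈ S, c • s = s → c = 1) :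
    ∑ s ∈ S, ψ s ∈ LinearMap.range (ρ.subgroupNorm C) := by
  classical
  have := Fintype.ofFinite C
  induction S using Finset.strongInduction with
  | H S ih =>
    rcases S.eq_empty_or_nonempty with rfl | ⟨s, hs⟩
    · simp
    let O : Finset α := Finset.univ.image fun c : C => (c : G) • s
    have hO : O ⊆ S := by
      intro t ht
      obtain ⟨c, -, rfl⟩ := Finset.mem_image.1 ht
      exact hS c c.2 s hs
    have hsO : s ∈ O := Finset.mem_image.2 ⟨1, Finset.mem_univ _, by simp⟩
    rw [← Finset.sum_sdiff hO]
    refine add_mem (ih _ (Finset.sdiff_ssubset hO ⟨s, hsO⟩) ?_ ?_) ⟨ψ s, ?_⟩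
    · intro c hc t ht
      rw [Finset.mem_sdiff] at ht ⊢
      refine ⟨hS c hc t ht.1, fun h => ht.2 ?_⟩
      obtain ⟨d, -, hd⟩ := Finset.mem_image.1 h
      refine Finset.mem_image.2 ⟨⟨c, hc⟩⁻¹ * d, Finset.mem_univ _, ?_⟩
      rw [Subgroup.coe_mul, mul_smul, hd]
      simp
    · exact fun c hc t ht => hfree c hc t (Finset.mem_sdiff.1 ht).1
    · rw [subgroupNorm_apply, Finset.sum_image]
      · exact Finset.sum_congr rfl fun c _ => (hψ c c.2 s).symm
      · intro c _ d _ hcd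
        have : (c⁻¹ * d : C) = 1 := by
          refine Subtype.ext (hfree _ (c⁻¹ * d : C).2 s hs ?_)
          have hcd' : (c : G) • s = (d : G) • s := hcd
          rw [Subgroup.coe_mul, mul_smul, ← hcd']
          simp
        exact inv_mul_eq_one.1 this

/-- Schur's lemma for the relative trace of an operator commuting with a subgroup `C`. -/
theorem exists_relative_trace [IsAlgClosed F] [FiniteDimensional F M] [Nontrivial M]
    (hirred : ∀ P : Submodule F M, (∀ (g : G) (x : M), x ∈ P → ρ g x ∈ P) → P = ⊥ ∨ P = ⊤)
    {C : Subgroup G} {z : G} (hz : z ∉ C)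
    (hTI : ∀ g, g ∉ C → z⁻¹ * g ∉ C → ∀ c ∈ C, g⁻¹ * c * g ∈ C → c = 1)
    (hnorm : ∀ c ∈ C, z⁻¹ * c * z ∈ C)
    (f : Module.End F M) (hf : ∀ c ∈ C, Commute f (ρ c)) :
    ∃ μ : F, ∀ v, (∀ c ∈ C, ρ c v = v) →
      μ • v - (f v + ρ z (f (ρ z⁻¹ v))) ∈ LinearMap.range (ρ.subgroupNorm C) := by
  classical
  have := Fintype.ofFinite (G ⧸ C)
  have hρ : ∀ g h v, ρ (g * h) v = ρ g (ρ h v) := fun g h v => by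
    rw [map_mul, Module.End.mul_apply]
  let Φ : G ⧸ C → Module.End F M := Quotient.lift (fun g => ρ g * f * ρ g⁻¹) (by
    intro a b hab
    have hab' : a⁻¹ * b ∈ C := QuotientGroup.leftRel_apply.1 hab
    have hc := hf _ hab'
    have h1 : ρ b = ρ a * ρ (a⁻¹ * b) := by rw [← map_mul, mul_inv_cancel_left]
    have h2 : ρ (a⁻¹ * b) * ρ b⁻¹ = ρ a⁻¹ := by rw [← map_mul]; simp
    change ρ a * f * ρ a⁻¹ = ρ b * f * ρ b⁻¹
    rw [h1, mul_assoc (ρ a) (ρ (a⁻¹ * b)) f, ← hc.eq]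
    simp only [mul_assoc, h2])
  have hΦ : ∀ g : G, ∀ v, Φ (g : G ⧸ C) v = ρ g (f (ρ g⁻¹ v)) := fun g v => rfl
  have hsmul : ∀ (h : G) (p : G ⧸ C) (v : M), Φ (h • p) v = ρ h (Φ p (ρ h⁻¹ v)) := by
    intro h p v
    induction p using QuotientGroup.induction_on with | _ g =>
    change Φ ((h * g : G) : G ⧸ C) v = _
    rw [hΦ, hΦ, mul_inv_rev, hρ, hρ]
  let T : Module.End F M := ∑ p, Φ p
  have hT : ∀ (g : G) v, T (ρ g v) = ρ g (T v) := by
    intro g v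
    simp only [T, LinearMap.sum_apply, map_sum]
    rw [← Equiv.sum_comp (MulAction.toPerm g)]
    refine Finset.sum_congr rfl fun p _ => ?_
    rw [MulAction.toPerm_apply, hsmul, ← hρ, inv_mul_cancel, map_one]
    rfl
  obtain ⟨μ, hμ⟩ := Module.End.exists_eigenvalue T
  have htop : Module.End.eigenspace T μ = ⊤ := by
    refine (hirred _ ?_).resolve_left hμ
    intro g x hx
    rw [Module.End.mem_eigenspace_iff] at hx ⊢
    rw [hT, hx, map_smul]
  refine ⟨μ, fun v hv => ?_⟩
  have hTv : T v = μ • v := Module.End.mem_eigenspace_iff.1 (htop ▸ Submodule.mem_top)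
  let S : Finset (G ⧸ C) := {((1 : G) : G ⧸ C), (z : G ⧸ C)}
  have hmem : ∀ g : G, (g : G ⧸ C) ∈ S ↔ g ∈ C ∨ z⁻¹ * g ∈ C := by
    intro g
    rw [Finset.mem_insert, Finset.mem_singleton, eq_comm, QuotientGroup.eq,
      @eq_comm _ (g : G ⧸ C), QuotientGroup.eq]
    simp
  have hne : ((1 : G) : G ⧸ C) ≠ (z : G ⧸ C) := by
    rw [Ne, QuotientGroup.eq]
    simpa using hz
  have hsum : μ • v - (f v + ρ z (f (ρ z⁻¹ v))) = ∑ p ∈ Sᶜ, Φ p v := by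
    rw [← hTv, sub_eq_iff_eq_add, show T v = ∑ p, Φ p v from LinearMap.sum_apply _ _ _,
      ← Finset.sum_compl_add_sum S, Finset.sum_pair hne, hΦ, hΦ]
    simp
  rw [hsum]
  refine sum_mem_range_subgroupNorm ?_ _ ?_ ?_
  · intro c hc p
    rw [hsmul, hv _ (C.inv_mem hc)]
  · intro c hc p hp
    induction p using QuotientGroup.induction_on with | _ g =>
    rw [Finset.mem_compl] at hp ⊢
    intro h
    apply hp
    rw [hmem]
    rcases (hmem (c * g)).1 h with h | h
    · left
      simpa using C.mul_mem (C.inv_mem hc) h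
    · right
      have := C.mul_mem (C.inv_mem (hnorm c hc)) h
      simpa [mul_assoc] using this
  · intro c hc p hp hcp
    induction p using QuotientGroup.induction_on with | _ g =>
    rw [Finset.mem_compl, hmem, not_or] at hp
    have h : ((c * g : G) : G ⧸ C) = (g : G ⧸ C) := hcp
    rw [eq_comm, QuotientGroup.eq, ← mul_assoc] at h
    exact hTI g hp.1 hp.2 c hc h

theorem isTwoCoboundaryOn_top_of_map_eq [NeZero (2 : F)] {f : G → G → M}
    (hf : ρ.IsTwoCocycle f) {c z : G} (hzc : z * c * z⁻¹ = c⁻¹) (hz : ∀ v, ρ z v = v)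
    (hidx : ((Subgroup.zpowers c).index : F) ≠ 0) : ρ.IsTwoCoboundaryOn ⊤ f := by
  refine hf.isTwoCoboundaryOn_top _ hidx (hf.isTwoCoboundaryOn_zpowers ?_)
  have h := hf.cyclicSum_add_map_mem hzc
  rw [hz, ← two_smul F] at h
  simpa only [inv_smul_smul₀ (two_ne_zero : (2 : F) ≠ 0)] using
    (LinearMap.range _).smul_mem (2 : F)⁻¹ h

theorem finrank_H2_le_one_of_dihedral [NeZero (2 : F)] [IsAlgClosed F] [FiniteDimensional F M]
    [Nontrivial M]
    (hirred : ∀ P : Submodule F M, (∀ (g : G) (x : M), x ∈ P → ρ g x ∈ P) → P = ⊥ ∨ P = ⊤)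
    {c z : G} (hzz : z * z = 1) (hzc : z * c * z⁻¹ = c⁻¹) (hz : z ∉ Subgroup.zpowers c)
    (hidx : ((Subgroup.zpowers c).index : F) ≠ 0)
    (hTI : ∀ g, g ∉ Subgroup.zpowers c → z⁻¹ * g ∉ Subgroup.zpowers c →
      ∀ d ∈ Subgroup.zpowers c, g⁻¹ * d * g ∈ Subgroup.zpowers c → d = 1) :
    Module.finrank F (groupCohomology (Rep.of ρ) 2) ≤ 1 := by
  refine finrank_H2_le_one_of_dependent ρ fun f₁ f₂ hf₁ hf₂ => ?_
  have h2 : (2 : F) ≠ 0 := two_ne_zero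
  have hρ : ∀ g h v, ρ (g * h) v = ρ g (ρ h v) := fun g h v => by
    rw [map_mul, Module.End.mul_apply]
  have hzinv : z⁻¹ = z := inv_eq_of_mul_eq_one_left hzz
  set R := LinearMap.range (ρ.subgroupNorm (Subgroup.zpowers c)) with hR
  have hcinv : z * c⁻¹ * z⁻¹ = c := by rw [← inv_inj, ← conj_inv, inv_inv, hzc]
  have hfix : ∀ v, ρ c v = v → ∀ d ∈ Subgroup.zpowers c, ρ d v = v := by
    intro v hv d hd
    obtain ⟨k, rfl⟩ := (isOfFinOrder_of_finite c).mem_powers_iff_mem_zpowers.2 hd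
    induction k with
    | zero => simp
    | succ k ih =>
      simp only at ih ⊢
      rw [pow_succ, hρ, hv, ih ⟨k, by simp⟩]
  let a : (G → G → M) → M := fun f => (2 : F)⁻¹ • (cyclicSum f c - ρ z (cyclicSum f c))
  have ha : ∀ f, ρ.IsTwoCocycle f → cyclicSum f c - a f ∈ R := by
    intro f hf
    have : cyclicSum f c - a f = (2 : F)⁻¹ • (cyclicSum f c + ρ z (cyclicSum f c)) := by
      have e : cyclicSum f c = (2 : F)⁻¹ • (2 : F) • cyclicSum f c := by
        rw [inv_smul_smul₀ h2]
      simp only [a]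
      nth_rewrite 1 [e]
      module
    rw [this]
    exact R.smul_mem _ (hf.cyclicSum_add_map_mem hzc)
  have hza : ∀ f, ρ z (a f) = - a f := by
    intro f
    simp only [a, map_smul, map_sub, ← hρ, hzz, map_one, Module.End.one_apply]
    module
  have hca : ∀ f, ρ.IsTwoCocycle f → ρ c (a f) = a f := by
    intro f hf
    have e : c * z = z * c⁻¹ := by rw [← mul_inv_eq_iff_eq_mul.1 hcinv]
    have e' : ρ c⁻¹ (cyclicSum f c) = cyclicSum f c := hfix _ (hf.map_cyclicSum c) _
      (inv_mem (Subgroup.mem_zpowers c))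
    simp only [a, map_smul, map_sub, ← hρ, e]
    rw [hρ z, e', hf.map_cyclicSum]
  clear_value a
  have key : ∃ s t : F, (s ≠ 0 ∨ t ≠ 0) ∧ s • a f₁ + t • a f₂ ∈ R := by
    by_contra! hcon
    let W := Submodule.span F {a f₁, a f₂}
    have hWmem : ∀ v ∈ W, ∃ s t : F, s • a f₁ + t • a f₂ = v := fun v hv =>
      Submodule.mem_span_pair.1 hv
    have hWR : ∀ v ∈ W, v ∈ R → v = 0 := by
      intro v hv hvR
      obtain ⟨s, t, rfl⟩ := hWmem v hv
      by_contra h0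
      refine hcon s t ?_ hvR
      by_contra! hst
      exact h0 (by rw [hst.1, hst.2]; simp)
    have hWc : ∀ v ∈ W, ρ c v = v := by
      intro v hv
      obtain ⟨s, t, rfl⟩ := hWmem v hv
      rw [map_add, map_smul, map_smul, hca _ hf₁, hca _ hf₂]
    have hWz : ∀ v ∈ W, ρ z⁻¹ v = -v := by
      intro v hv
      obtain ⟨s, t, rfl⟩ := hWmem v hv
      rw [hzinv, map_add, map_smul, map_smul, hza, hza]
      module
    have hli : LinearIndependent F ![a f₁, a f₂] := by
      rw [LinearIndependent.pair_iff]
      intro s t hst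
      by_contra h
      refine hcon s t ?_ (by rw [hst]; exact R.zero_mem)
      tauto
    have hW2 : Module.finrank F W = 2 := by
      have := finrank_span_eq_card hli
      rwa [Matrix.range_cons, Matrix.range_cons, Matrix.range_empty, Set.union_empty,
        Fintype.card_fin, Set.singleton_union] at this
    obtain ⟨f, hfx, u, hu, w, hw, hu0, hw0, hfu, hfw⟩ :=
      exists_commute_of_mem_ker (ρ c - 1) (W := W)
        (fun v hv => by simp [hWc v hv]) hW2.ge
    have hfc : Commute f (ρ c) := by
      have := hfx.add_right (Commute.one_right f)
      rwa [sub_add_cancel] at this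
    have hnorm : ∀ d ∈ Subgroup.zpowers c, z⁻¹ * d * z ∈ Subgroup.zpowers c := by
      rintro _ ⟨k, rfl⟩
      refine ⟨-k, ?_⟩
      have h := conj_zpow (i := k) (a := z) (b := c)
      rw [hzc] at h
      rw [hzinv]
      rw [hzinv] at h
      simp only [← h, inv_zpow']
    have hfall : ∀ d ∈ Subgroup.zpowers c, Commute f (ρ d) := by
      intro d hd
      obtain ⟨k, rfl⟩ := (isOfFinOrder_of_finite c).mem_powers_iff_mem_zpowers.2 hd
      simp only [map_pow]
      exact hfc.pow_right k
    obtain ⟨μ, hμ⟩ := exists_relative_trace hirred hz hTI hnorm f hfall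
    have hu' := hμ u (hfix u (hWc u hu))
    have hw' := hμ w (hfix w (hWc w hw))
    rw [hWz w hw, map_neg, hfw, neg_zero, map_zero, add_zero, sub_zero] at hw'
    have hμ0 : μ = 0 := (smul_eq_zero.1 (hWR _ (W.smul_mem μ hw) hw')).resolve_right hw0
    rw [hWz u hu, map_neg, hfu, hμ0, map_neg, ← hzinv, hWz u hu] at hu'
    have : (-2 : F) • u = 0 := by
      refine hWR _ (W.smul_mem _ hu) ?_
      convert hu' using 1
      module
    rw [smul_eq_zero, neg_eq_zero] at this
    tauto
  obtain ⟨s, t, hst, hR'⟩ := key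
  refine ⟨s, t, hst, ((hf₁.smul s).add (hf₂.smul t)).isTwoCoboundaryOn_top _ hidx
    (((hf₁.smul s).add (hf₂.smul t)).isTwoCoboundaryOn_zpowers ?_)⟩
  have e : cyclicSum (s • f₁ + t • f₂) c = s • cyclicSum f₁ c + t • cyclicSum f₂ c := by
    have := Fintype.ofFinite (Subgroup.zpowers c)
    simp only [cyclicSum_eq, Pi.add_apply, Pi.smul_apply, Finset.sum_add_distrib,
      Finset.smul_sum]
  rw [e]
  convert R.add_mem hR' (R.add_mem (R.smul_mem s (ha _ hf₁)) (R.smul_mem t (ha _ hf₂))) using 1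
  module

end Representation

namespace Matrix.SpecialLinearGroup

open Representation

variable {K : Type} [Field K]

/-- The upper unitriangular matrix with corner entry `b`. -/
def upper (b : K) : SpecialLinearGroup (Fin 2) K :=
  ⟨!![1, b; 0, 1], by simp [Matrix.det_fin_two]⟩

/-- The diagonal matrix with entries `a` and `a⁻¹`. -/
def torus (a : Kˣ) : SpecialLinearGroup (Fin 2) K :=
  ⟨!![(a : K), 0; 0, ((a⁻¹ : Kˣ) : K)], by simp [Matrix.det_fin_two]⟩

variable (K) in
/-- The permutation matrix, which has determinant one in characteristic two. -/
def weyl [CharP K 2] : SpecialLinearGroup (Fin 2) K :=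
  ⟨!![0, 1; 1, 0], by simp [Matrix.det_fin_two, CharTwo.neg_eq]⟩

theorem coe_upper (b : K) :
    (upper b : Matrix (Fin 2) (Fin 2) K) = !![1, b; 0, 1] := rfl

theorem coe_torus (a : Kˣ) :
    (torus a : Matrix (Fin 2) (Fin 2) K) = !![(a : K), 0; 0, ((a⁻¹ : Kˣ) : K)] := rfl

theorem coe_weyl [CharP K 2] : (weyl K : Matrix (Fin 2) (Fin 2) K) = !![0, 1; 1, 0] := rfl

theorem upper_mul (b b' : K) : upper b * upper b' = upper (b + b') := by
  ext i j
  rw [coe_mul, coe_upper, coe_upper, coe_upper]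
  fin_cases i <;> fin_cases j <;> simp [Matrix.mul_apply, Fin.sum_univ_two, add_comm]

theorem upper_zero : upper (0 : K) = 1 := by
  ext i j
  rw [coe_upper]
  fin_cases i <;> fin_cases j <;> simp

theorem torus_mul (a a' : Kˣ) : torus a * torus a' = torus (a * a') := by
  ext i j
  rw [coe_mul, coe_torus, coe_torus, coe_torus]
  fin_cases i <;> fin_cases j <;> simp [Matrix.mul_apply, Fin.sum_univ_two, mul_comm]

variable (K) in
/-- The split torus as a homomorphism. -/
def torusHom : Kˣ →* SpecialLinearGroup (Fin 2) K where
  toFun := torus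
  map_one' := by
    ext i j
    rw [coe_torus]
    fin_cases i <;> fin_cases j <;> simp
  map_mul' a a' := (torus_mul a a').symm

variable (K) in
/-- The unipotent subgroup as a homomorphism. -/
def upperHom : Multiplicative K →* SpecialLinearGroup (Fin 2) K where
  toFun b := upper b.toAdd
  map_one' := upper_zero
  map_mul' _ _ := (upper_mul _ _).symm

theorem torus_mul_upper (a : Kˣ) (b : K) :
    torus a * upper b = upper ((a : K) ^ 2 * b) * torus a := by
  ext i j
  rw [coe_mul, coe_mul, coe_upper, coe_upper, coe_torus]
  fin_cases i <;> fin_cases j <;> simp [Matrix.mul_apply, Fin.sum_univ_two]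
  field_simp

theorem exists_eq_torus_mul_upper (g : SpecialLinearGroup (Fin 2) K) (h : g 1 0 = 0) :
    ∃ a b, g = torus a * upper b := by
  have hd := g.det_coe
  rw [Matrix.det_fin_two, h, mul_zero, sub_zero] at hd
  have h0 : g 0 0 ≠ 0 := left_ne_zero_of_mul_eq_one hd
  refine ⟨Units.mk0 _ h0, g 0 1 / g 0 0, ?_⟩
  ext i j
  rw [coe_mul, coe_torus, coe_upper]
  fin_cases i <;> fin_cases j <;> simp [Matrix.mul_apply, Fin.sum_univ_two, h]
  · field_simp
  · exact eq_inv_of_mul_eq_one_right hd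

theorem natCard_fin_two [Finite K] : Nat.card (SpecialLinearGroup (Fin 2) K) =
    Nat.card K * (Nat.card K ^ 2 - 1) := by
  classical
  have := Fintype.ofFinite K
  let φ : SpecialLinearGroup (Fin 2) K → K × {v : K × K // v ≠ 0} := fun g =>
    (if g 1 0 = 0 then g 0 1 else g 1 1, ⟨(g 0 0, g 1 0), fun h => by
      have hd := g.det_coe
      have h1 : g 0 0 = 0 := (Prod.ext_iff.1 h).1
      have h2 : g 1 0 = 0 := (Prod.ext_iff.1 h).2
      rw [Matrix.det_fin_two, h1, h2] at hd
      simp at hd⟩)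
  have hφ : Function.Bijective φ := by
    constructor
    · intro g h hgh
      have hd := g.det_coe
      have hd' := h.det_coe
      rw [Matrix.det_fin_two] at hd hd'
      simp only [φ, Prod.mk.injEq, Subtype.mk.injEq] at hgh
      obtain ⟨h1, h2, h3⟩ := hgh
      rw [← h3] at h1 hd'
      rw [← h2] at hd'
      by_cases hc : g 1 0 = 0
      · rw [if_pos hc, if_pos hc] at h1
        rw [hc, mul_zero, sub_zero] at hd hd'
        have h4 : g 1 1 = h 1 1 :=
          mul_left_cancel₀ (left_ne_zero_of_mul_eq_one hd) (hd.trans hd'.symm)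
        ext i j
        fin_cases i <;> fin_cases j <;> assumption
      · rw [if_neg hc, if_neg hc] at h1
        have h4 : g 0 1 = h 0 1 := by
          refine mul_right_cancel₀ hc ?_
          rw [← h1] at hd'
          linear_combination hd' - hd
        ext i j
        fin_cases i <;> fin_cases j <;> assumption
    · rintro ⟨y, ⟨p, r⟩, hv⟩
      by_cases hr : r = 0
      · have hp : p ≠ 0 := by
          rintro rfl
          exact hv (by rw [hr]; rfl)
        refine ⟨⟨!![p, y; 0, p⁻¹], by simp [Matrix.det_fin_two, hp]⟩, ?_⟩
        simp [φ, hr]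
      · refine ⟨⟨!![p, (p * y - 1) / r; r, y], ?_⟩, ?_⟩
        · simp only [Matrix.det_fin_two_of]
          field_simp
          ring
        · simp [φ, hr]
  rw [Nat.card_congr (Equiv.ofBijective φ hφ), Nat.card_prod]
  congr 1
  rw [Nat.card_eq_fintype_card, Nat.card_eq_fintype_card, Fintype.card_subtype_compl,
    Fintype.card_prod, Fintype.card_subtype_eq, sq]

theorem upper_injective : Function.Injective (upper (K := K)) := by
  intro a b h
  have := congrArg (fun g : SpecialLinearGroup (Fin 2) K => g 0 1) h
  simpa [coe_upper] using this

theorem torus_injective : Function.Injective (torus (K := K)) := by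
  intro a b h
  have := congrArg (fun g : SpecialLinearGroup (Fin 2) K => g 0 0) h
  exact Units.ext (by simpa [coe_torus] using this)

theorem index_range_upperHom [Finite K] :
    (upperHom K).range.index = Nat.card K ^ 2 - 1 := by
  have h := (upperHom K).range.card_mul_index
  have hc : Nat.card (upperHom K).range = Nat.card K :=
    Nat.card_congr
    (MonoidHom.ofInjective (f := upperHom K) (upper_injective (K := K))).symm.toEquiv
  rw [natCard_fin_two, hc] at h
  exact Nat.eq_of_mul_eq_mul_left Nat.card_pos h

theorem mem_zpowers_torus {a : Kˣ} (ha : ∀ x, x ∈ Subgroup.zpowers a)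
    {g : SpecialLinearGroup (Fin 2) K} :
    g ∈ Subgroup.zpowers (torus a) ↔ g 0 1 = 0 ∧ g 1 0 = 0 := by
  constructor
  · rintro ⟨k, rfl⟩
    have : torus a ^ k = torus (a ^ k) := (map_zpow (torusHom K) a k).symm
    simp [this, coe_torus]
  · rintro ⟨h1, h2⟩
    obtain ⟨b, y, rfl⟩ := exists_eq_torus_mul_upper g h2
    have hy : y = 0 := by
      simpa [coe_torus, coe_upper, Matrix.mul_apply, Fin.sum_univ_two] using h1
    rw [hy, upper_zero, mul_one]
    obtain ⟨k, rfl⟩ := ha b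
    exact ⟨k, (map_zpow (torusHom K) a k).symm⟩

theorem index_zpowers_torus [Finite K] {a : Kˣ} (ha : ∀ x, x ∈ Subgroup.zpowers a) :
    (Subgroup.zpowers (torus a)).index = Nat.card K * (Nat.card K + 1) := by
  have h := (Subgroup.zpowers (torus a)).card_mul_index
  have hc : Nat.card (Subgroup.zpowers (torus a)) = Nat.card K - 1 := by
    rw [← Nat.card_units, Nat.card_zpowers]
    change orderOf (torusHom K a) = _
    rw [orderOf_injective _ torus_injective]
    exact orderOf_eq_card_of_forall_mem_zpowers ha
  have h1 : 1 < Nat.card K := Finite.one_lt_card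
  rw [natCard_fin_two, hc] at h
  refine Nat.eq_of_mul_eq_mul_left (Nat.sub_pos_of_lt h1) (h.trans ?_)
  obtain ⟨n, hn⟩ : ∃ n, Nat.card K = n + 1 := ⟨Nat.card K - 1, by omega⟩
  rw [hn, show (n + 1) ^ 2 - 1 = n * (n + 2) by
    rw [Nat.sub_eq_iff_eq_add (Nat.one_le_pow _ _ (by omega))]; ring]
  simp only [Nat.add_sub_cancel]
  ring

variable [CharP K 2]

theorem weyl_mul_weyl : weyl K * weyl K = 1 := by
  ext i j
  rw [coe_mul, coe_weyl]
  fin_cases i <;> fin_cases j <;> simp [Matrix.mul_apply, Fin.sum_univ_two]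

theorem weyl_mul_torus (a : Kˣ) : weyl K * torus a = torus a⁻¹ * weyl K := by
  ext i j
  rw [coe_mul, coe_mul, coe_torus, coe_torus, coe_weyl]
  fin_cases i <;> fin_cases j <;> simp [Matrix.mul_apply, Fin.sum_univ_two]

theorem weyl_mul_torus_eq (a : Kˣ) :
    weyl K * torus a = upper (a⁻¹ : K) * (weyl K * upper (a : K) * weyl K) * upper (a⁻¹ : K) := by
  ext i j
  simp only [coe_mul, coe_torus, coe_upper, coe_weyl]
  fin_cases i <;> fin_cases j <;>
    simp [Matrix.mul_apply, Fin.sum_univ_two, CharTwo.add_self_eq_zero]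

theorem exists_eq_bruhat (g : SpecialLinearGroup (Fin 2) K) (h : g 1 0 ≠ 0) :
    ∃ a b b', g = upper b * torus a * weyl K * upper b' := by
  have hd := g.det_coe
  rw [Matrix.det_fin_two] at hd
  refine ⟨(Units.mk0 _ h)⁻¹, g 0 0 / g 1 0, g 1 1 / g 1 0, ?_⟩
  ext i j
  simp only [coe_mul, coe_torus, coe_upper, coe_weyl]
  fin_cases i <;> fin_cases j <;> simp [Matrix.mul_apply, Fin.sum_univ_two, h]
  · field_simp
    have : (1 : K) = -1 := by rw [CharTwo.neg_eq]
    linear_combination -hd - this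
  · field_simp

theorem closure_eq_top {H : Subgroup (SpecialLinearGroup (Fin 2) K)} (hu : ∀ b, upper b ∈ H)
    (hw : weyl K ∈ H) : H = ⊤ := by
  have ht : ∀ a, torus a ∈ H := by
    intro a
    have : torus a = weyl K * (weyl K * torus a) := by
      rw [← mul_assoc, weyl_mul_weyl, one_mul]
    rw [this, weyl_mul_torus_eq]
    exact H.mul_mem hw (H.mul_mem (H.mul_mem (hu _)
      (H.mul_mem (H.mul_mem hw (hu _)) hw)) (hu _))
  rw [eq_top_iff]
  intro g _
  by_cases h : g 1 0 = 0
  · obtain ⟨a, b, rfl⟩ := exists_eq_torus_mul_upper g h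
    exact H.mul_mem (ht a) (hu b)
  · obtain ⟨a, b, b', rfl⟩ := exists_eq_bruhat g h
    exact H.mul_mem (H.mul_mem (H.mul_mem (hu b) (ht a)) hw) (hu b')

theorem eq_top_of_normal {H : Subgroup (SpecialLinearGroup (Fin 2) K)} [H.Normal]
    (hu : ∀ b, upper b ∈ H) : H = ⊤ := by
  refine closure_eq_top hu ?_
  have h := weyl_mul_torus_eq (1 : Kˣ)
  have h1 : torus (1 : Kˣ) = 1 := (torusHom K).map_one
  rw [h1, mul_one] at h
  rw [h]
  refine H.mul_mem (H.mul_mem (hu _) ?_) (hu _)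
  have := Subgroup.Normal.conj_mem ‹_› _ (hu ((1 : Kˣ) : K)) (weyl K)
  rwa [inv_eq_of_mul_eq_one_left weyl_mul_weyl] at this

theorem torus_trivial_intersection {a : Kˣ} (ha : ∀ x, x ∈ Subgroup.zpowers a)
    {g : SpecialLinearGroup (Fin 2) K} (hg : g ∉ Subgroup.zpowers (torus a))
    (hwg : (weyl K)⁻¹ * g ∉ Subgroup.zpowers (torus a))
    {d : SpecialLinearGroup (Fin 2) K} (hd : d ∈ Subgroup.zpowers (torus a))
    (hgd : g⁻¹ * d * g ∈ Subgroup.zpowers (torus a)) : d = 1 := by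
  obtain ⟨k, rfl⟩ := hd
  obtain ⟨l, hl⟩ := hgd
  have hz : ∀ k : ℤ, torus a ^ k = torus (a ^ k) := fun k => (map_zpow (torusHom K) a k).symm
  simp only [hz] at hl ⊢
  generalize a ^ k = x at hl ⊢
  generalize a ^ l = y at hl
  by_contra hx
  have hx1 : (x : K) - ((x⁻¹ : Kˣ) : K) ≠ 0 := by
    intro h
    rw [sub_eq_zero] at h
    apply hx
    have h2 : (x : K) * x = 1 := by
      nth_rewrite 2 [h]
      exact x.mul_inv
    have h3 : ((x : K) + 1) ^ 2 = 0 := by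
      rw [CharTwo.add_sq, sq, h2, one_pow, CharTwo.add_self_eq_zero]
    have h4 : x = 1 := by
      have := CharTwo.add_eq_zero.1 (pow_eq_zero_iff two_ne_zero |>.1 h3)
      exact Units.ext this
    rw [h4]
    exact (torusHom K).map_one
  have hl' : g * torus y = torus x * g := by rw [hl]; group
  rw [inv_eq_of_mul_eq_one_left weyl_mul_weyl] at hwg
  rw [mem_zpowers_torus ha] at hg hwg
  have ent : ∀ i j, (g * torus y) i j = (torus x * g) i j := fun i j => by rw [hl']
  have e00 := ent 0 0
  have e01 := ent 0 1
  have e10 := ent 1 0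
  have e11 := ent 1 1
  simp only [coe_mul, coe_torus, coe_weyl, Matrix.mul_apply, Fin.sum_univ_two, Matrix.of_apply,
    Matrix.cons_val_zero, Matrix.cons_val_one, Matrix.cons_val', Matrix.cons_val_fin_one,
    mul_zero, zero_mul, add_zero, zero_add, one_mul] at e00 e01 e10 e11 hwg
  by_cases h0 : g 0 0 = 0
  · have hdet := g.det_coe
    rw [Matrix.det_fin_two, h0, zero_mul, zero_sub] at hdet
    have h01 : g 0 1 ≠ 0 := fun h => by simp [h] at hdet
    have hyx : ((y⁻¹ : Kˣ) : K) = x := mul_left_cancel₀ h01 (by rw [e01, mul_comm])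
    have h11 : g 1 1 * ((x : K) - ((x⁻¹ : Kˣ) : K)) = 0 := by
      rw [hyx] at e11
      linear_combination e11
    exact hwg ⟨(mul_eq_zero.1 h11).resolve_right hx1, h0⟩
  · have hyx : (y : K) = x := mul_left_cancel₀ h0 (by rw [e00, mul_comm])
    obtain rfl : y = x := Units.ext hyx
    have h01 : g 0 1 * ((y : K) - ((y⁻¹ : Kˣ) : K)) = 0 := by linear_combination -e01
    have h10 : g 1 0 * ((y : K) - ((y⁻¹ : Kˣ) : K)) = 0 := by linear_combination e10
    exact hg ⟨(mul_eq_zero.1 h01).resolve_right hx1, (mul_eq_zero.1 h10).resolve_right hx1⟩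

end Matrix.SpecialLinearGroup

namespace Matrix.SpecialLinearGroup

variable {K L : Type} [Field K] [CharP K 2] [Field L] [Algebra K L]

theorem pow_card_add_one_ne {y : L} (hy : y ^ (Nat.card K + 1) = 1) (hy1 : y ≠ 1) :
    y ^ Nat.card K ≠ y := by
  intro h
  have : CharP L 2 := charP_of_injective_algebraMap (algebraMap K L).injective 2
  rw [pow_succ, h] at hy
  have h3 : (y + 1) ^ 2 = 0 := by
    rw [CharTwo.add_sq, sq, hy, one_pow, CharTwo.add_self_eq_zero]
  exact hy1 (CharTwo.add_eq_zero.1 (pow_eq_zero_iff two_ne_zero |>.1 h3))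

variable [Finite K]

theorem exists_eq_add_smul (hL : Module.finrank K L = 2) {y : L}
    (hy : y ^ (Nat.card K + 1) = 1) (hy1 : y ≠ 1) (t : L) : ∃ a b : K, a • 1 + b • y = t := by
  have := Fintype.ofFinite K
  have : FiniteDimensional K L := .of_finrank_pos (by omega)
  have hli : LinearIndependent K ![(1 : L), y] := by
    rw [LinearIndependent.pair_iff]
    intro a b hab
    have hb : b = 0 := by
      by_contra hb
      apply pow_card_add_one_ne hy hy1
      have : y = algebraMap K L (-a / b) := by
        rw [Algebra.smul_def, Algebra.smul_def, mul_one] at hab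
        have hb' : algebraMap K L b ≠ 0 := by simpa using hb
        rw [map_div₀, map_neg, eq_div_iff hb']
        linear_combination hab
      rw [this, ← map_pow, Nat.card_eq_fintype_card, FiniteField.pow_card]
    simpa [hb] using hab
  have htop := hli.span_eq_top_of_card_eq_finrank' (by rw [hL, Fintype.card_fin])
  have ht : t ∈ Submodule.span K (Set.range ![(1 : L), y]) := htop ▸ Submodule.mem_top
  rw [Matrix.range_cons, Matrix.range_cons, Matrix.range_empty, Set.union_empty,
    Set.singleton_union] at ht
  exact Submodule.mem_span_pair.1 ht

theorem map_eq_mul_map_one (hL : Module.finrank K L = 2) {y : L}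
    (hy : y ^ (Nat.card K + 1) = 1) (hy1 : y ≠ 1) {γ : L →ₗ[K] L}
    (hγ : ∀ t, γ (y * t) = y * γ t) (t : L) : γ t = t * γ 1 := by
  obtain ⟨a, b, rfl⟩ := exists_eq_add_smul hL hy hy1 t
  have := hγ 1
  rw [mul_one] at this
  rw [map_add, map_smul, map_smul, this, add_mul, smul_mul_assoc, smul_mul_assoc, one_mul]

theorem eq_or_eq_pow_of_conj (hL : Module.finrank K L = 2) {σ : L ≃ₐ[K] L}
    (hσ : ∀ x, σ x = x ^ Nat.card K) {x y : L} (hy : y ^ (Nat.card K + 1) = 1) (hy1 : y ≠ 1)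
    {γ : L →ₗ[K] L} (h1 : γ 1 ≠ 0) (hγ : ∀ t, γ (y * t) = x * γ t) :
    x = y ∨ x = y ^ Nat.card K := by
  obtain ⟨a, b, hab⟩ := exists_eq_add_smul hL hy hy1 (y * y)
  have hx : (a • 1 + b • x : L) = x * x := by
    refine mul_right_cancel₀ h1 ?_
    have e := hγ 1
    rw [mul_one] at e
    rw [mul_assoc, ← e, ← hγ, ← hab, map_add, map_smul, map_smul, e, add_mul, smul_mul_assoc,
      smul_mul_assoc, one_mul]
  have hy' : (a • 1 + b • σ y : L) = σ y * σ y := by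
    rw [← map_mul, ← hab, map_add, map_smul, map_smul, map_one]
  have hne : y - σ y ≠ 0 := by
    rw [sub_ne_zero, hσ]
    exact (pow_card_add_one_ne hy hy1).symm
  rw [← hσ]
  simp only [Algebra.smul_def, mul_one] at hab hx hy'
  have hs : algebraMap K L b = y + σ y := by
    refine mul_left_cancel₀ hne ?_
    linear_combination hab - hy'
  rw [hs] at hab hx
  have : (x - y) * (x - σ y) = 0 := by linear_combination hab - hx
  rcases mul_eq_zero.1 this with h | h
  · exact Or.inl (sub_eq_zero.1 h)
  · exact Or.inr (sub_eq_zero.1 h)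

theorem exists_nonsplit_torus_of_extension [Finite L] (hL : Module.finrank K L = 2)
    (σ : L ≃ₐ[K] L) (hσ : ∀ x, σ x = x ^ Nat.card K) :
    ∃ c z : SpecialLinearGroup (Fin 2) K, z * z = 1 ∧ z * c * z⁻¹ = c⁻¹ ∧
      z ∉ Subgroup.zpowers c ∧
      (Subgroup.zpowers c).index = Nat.card K * (Nat.card K - 1) ∧
      ∀ g, g ∉ Subgroup.zpowers c → z⁻¹ * g ∉ Subgroup.zpowers c →
        ∀ d ∈ Subgroup.zpowers c, g⁻¹ * d * g ∈ Subgroup.zpowers c → d = 1 := by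
  classical
  have := Fintype.ofFinite K
  have := Fintype.ofFinite L
  have : Module.Finite K L := .of_finite
  have hq : 1 < Nat.card K := Finite.one_lt_card
  have hcardL : Nat.card L = Nat.card K ^ 2 := by rw [← hL, Module.natCard_eq_pow_finrank (K := K)]
  have hfac : Nat.card K ^ 2 - 1 = (Nat.card K + 1) * (Nat.card K - 1) := by
    rw [← Nat.sq_sub_sq, one_pow]
  have hpow : ∀ x : L, x ≠ 0 → x ^ ((Nat.card K + 1) * (Nat.card K - 1)) = 1 := by
    intro x hx
    rw [← hfac, ← hcardL, Nat.card_eq_fintype_card]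
    exact FiniteField.pow_card_sub_one_eq_one x hx
  have hσσ : ∀ x, σ (σ x) = x := fun x => by
    rw [hσ, hσ, ← pow_mul, ← sq, ← hcardL, Nat.card_eq_fintype_card, FiniteField.pow_card]
  let bas : Module.Basis (Fin 2) K L := Module.finBasisOfFinrankEq K L hL
  let A : SpecialLinearGroup (Fin 2) K → (L →ₗ[K] L) := fun g => Matrix.toLin bas bas g.1
  have hAinj : ∀ {g h}, A g = A h → g = h := fun {g h} e =>
    Subtype.ext ((Matrix.toLin bas bas).injective e)
  have hAmul : ∀ g h, A (g * h) = A g ∘ₗ A h := fun g h => by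
    simp only [A]
    exact Matrix.toLin_mul bas bas bas g.1 h.1
  have hAone : A 1 = LinearMap.id := by
    simp only [A]
    exact Matrix.toLin_one bas
  have hAsurj : ∀ f : L →ₗ[K] L, LinearMap.det f = 1 → ∃ g, A g = f := fun f hf =>
    ⟨⟨LinearMap.toMatrix bas bas f, by rw [LinearMap.det_toMatrix, hf]⟩,
      Matrix.toLin_toMatrix bas bas f⟩
  have hAdet : ∀ g, LinearMap.det (A g) = 1 := fun g => by
    simp only [A]
    rw [LinearMap.det_toLin]
    exact g.2
  have hnorm : ∀ x : L, LinearMap.det (Algebra.lmul K L x) = 1 ↔ x ^ (Nat.card K + 1) = 1 := by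
    intro x
    rw [← (algebraMap K L).injective.eq_iff, map_one]
    change algebraMap K L (Algebra.norm K x) = 1 ↔ _
    rw [FiniteField.algebraMap_norm_eq_pow, hcardL, hfac, Nat.mul_div_cancel _ (by omega)]
  obtain ⟨g₀, hg₀⟩ := IsCyclic.exists_generator (α := Lˣ)
  let ζ : Lˣ := g₀ ^ (Nat.card K - 1)
  have hcyc : ∀ x : L, x ^ (Nat.card K + 1) = 1 → ∃ k : ℕ, (ζ : L) ^ k = x := by
    intro x hx
    have hx0 : x ≠ 0 := by
      rintro rfl
      simp at hx
    obtain ⟨k, hk⟩ := (isOfFinOrder_of_finite g₀).mem_powers_iff_mem_zpowers.2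
      (hg₀ (Units.mk0 x hx0))
    simp only at hk
    have h1 : g₀ ^ (k * (Nat.card K + 1)) = 1 := by
      rw [pow_mul, hk]
      exact Units.ext (by simpa using hx)
    rw [← orderOf_dvd_iff_pow_eq_one, orderOf_eq_card_of_forall_mem_zpowers hg₀, Nat.card_units,
      hcardL, hfac, mul_comm] at h1
    obtain ⟨l, rfl⟩ := Nat.dvd_of_mul_dvd_mul_right (Nat.succ_pos _) h1
    refine ⟨l, ?_⟩
    rw [← Units.val_pow_eq_pow_val, ← pow_mul, hk]
    rfl
  have hζ : (ζ : L) ^ (Nat.card K + 1) = 1 := by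
    rw [Units.val_pow_eq_pow_val, ← pow_mul, mul_comm]
    exact hpow _ g₀.ne_zero
  have hζord : orderOf ζ = Nat.card K + 1 := by
    rw [orderOf_pow, orderOf_eq_card_of_forall_mem_zpowers hg₀, Nat.card_units, hcardL, hfac,
      Nat.gcd_mul_left_left, Nat.mul_div_cancel _ (by omega)]
  obtain ⟨c, hc⟩ := hAsurj _ ((hnorm ζ).2 hζ)
  have hσdet : LinearMap.det (σ.toLinearMap) = 1 := by
    have h : LinearMap.det (σ.toLinearMap ∘ₗ σ.toLinearMap) = 1 := by
      rw [show σ.toLinearMap ∘ₗ σ.toLinearMap = LinearMap.id from LinearMap.ext hσσ,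
        LinearMap.det_id]
    rw [LinearMap.det_comp] at h
    have h3 : (LinearMap.det (σ.toLinearMap) + 1) ^ 2 = 0 := by
      rw [CharTwo.add_sq, sq, h, one_pow, CharTwo.add_self_eq_zero]
    exact CharTwo.add_eq_zero.1 (pow_eq_zero_iff two_ne_zero |>.1 h3)
  obtain ⟨z, hz⟩ := hAsurj _ hσdet
  have hcpow : ∀ k : ℕ, A (c ^ k) = Algebra.lmul K L ((ζ : L) ^ k) := by
    intro k
    induction k with
    | zero =>
      rw [pow_zero, pow_zero, hAone, map_one]
      rfl
    | succ k ih =>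
      rw [pow_succ, hAmul, ih, hc, pow_succ, map_mul]
      rfl
  have hmem : ∀ g, g ∈ Subgroup.zpowers c ↔
      ∃ x : L, x ^ (Nat.card K + 1) = 1 ∧ A g = Algebra.lmul K L x := by
    intro g
    rw [← (isOfFinOrder_of_finite c).mem_powers_iff_mem_zpowers]
    constructor
    · rintro ⟨k, rfl⟩
      exact ⟨(ζ : L) ^ k, by rw [← pow_mul, mul_comm, pow_mul, hζ, one_pow], hcpow k⟩
    · rintro ⟨x, hx, hg⟩
      obtain ⟨k, rfl⟩ := hcyc x hx
      exact ⟨k, hAinj ((hcpow k).trans hg.symm)⟩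
  have hcomm : ∀ {g : SpecialLinearGroup (Fin 2) K} {y : L}, y ^ (Nat.card K + 1) = 1 → y ≠ 1 →
      (∀ t, A g (y * t) = y * A g t) → g ∈ Subgroup.zpowers c := by
    intro g y hy hy1 h
    have e : A g = Algebra.lmul K L (A g 1) := LinearMap.ext fun t => by
      rw [map_eq_mul_map_one hL hy hy1 h t, mul_comm]
      rfl
    rw [hmem]
    refine ⟨A g 1, (hnorm _).1 ?_, e⟩
    rw [← e]
    exact hAdet g
  have hzz : z * z = 1 := hAinj (by
    rw [hAmul, hz, hAone]
    exact LinearMap.ext hσσ)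
  refine ⟨c, z, hzz, ?_, ?_, ?_, ?_⟩
  · rw [mul_inv_eq_iff_eq_mul, eq_inv_mul_iff_mul_eq]
    apply hAinj
    rw [hAmul, hAmul, hc, hz]
    refine LinearMap.ext fun t => ?_
    change (ζ : L) * σ (ζ * t) = σ t
    rw [map_mul, hσ ζ, ← mul_assoc, ← pow_succ', hζ, one_mul]
  · intro h
    obtain ⟨x, hx, h⟩ := (hmem z).1 h
    rw [hz] at h
    have h1 := congrArg (fun f => f (1 : L)) h
    have h2 := congrArg (fun f => f (ζ : L)) h
    change σ 1 = x * 1 at h1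
    change σ ζ = x * ζ at h2
    rw [map_one, mul_one] at h1
    rw [← h1, one_mul, hσ] at h2
    refine pow_card_add_one_ne hζ ?_ h2
    intro h3
    have h4 : ζ = 1 := Units.ext h3
    rw [h4, orderOf_one] at hζord
    omega
  · have hord : orderOf c = Nat.card K + 1 := by
      rw [← hζord]
      refine orderOf_eq_orderOf_iff.2 fun k => ?_
      constructor
      · intro h
        have := hcpow k
        rw [h, hAone] at this
        have h1 := congrArg (fun f => f (1 : L)) this
        refine Units.ext ?_
        have h2 : (1 : L) = ζ ^ k * 1 := h1
        rw [mul_one] at h2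
        rw [Units.val_pow_eq_pow_val, ← h2]
        rfl
      · intro h
        apply hAinj
        rw [hcpow, ← Units.val_pow_eq_pow_val, h, hAone, Units.val_one, map_one]
        rfl
    have h := (Subgroup.zpowers c).card_mul_index
    rw [Nat.card_zpowers, hord, natCard_fin_two, hfac, mul_left_comm] at h
    exact Nat.eq_of_mul_eq_mul_left (Nat.succ_pos _) h
  · intro g hg hzg d hd hgd
    by_contra hd1
    obtain ⟨x, hx, hdx⟩ := (hmem d).1 hd
    obtain ⟨y, hy, hdy⟩ := (hmem _).1 hgd
    have hxy : ∀ t, A g (y * t) = x * A g t := by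
      intro t
      have : A (d * g) = A (g * (g⁻¹ * d * g)) := by
        congr 1
        group
      rw [hAmul, hAmul, hdx, hdy] at this
      exact (congrArg (fun f => f t) this).symm
    have hAg1 : A g 1 ≠ 0 := by
      intro h
      have e : (A g⁻¹ ∘ₗ A g) 1 = 1 := by rw [← hAmul, inv_mul_cancel, hAone]; rfl
      rw [LinearMap.comp_apply, h, map_zero] at e
      exact zero_ne_one e
    have hy1 : y ≠ 1 := by
      rintro rfl
      apply hd1
      have e : g⁻¹ * d * g = 1 := hAinj (by rw [hdy, hAone, map_one]; rfl)
      simpa [mul_assoc] using congrArg (fun x => g * x * g⁻¹) e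
    rcases eq_or_eq_pow_of_conj hL hσ hy hy1 hAg1 hxy with rfl | rfl
    · exact hg (hcomm hy hy1 hxy)
    · rw [inv_eq_of_mul_eq_one_left hzz] at hzg
      refine hzg (hcomm hy hy1 fun t => ?_)
      rw [hAmul, hz]
      change σ (A g (y * t)) = y * σ (A g t)
      rw [hxy, map_mul, ← hσ, hσσ]

theorem exists_nonsplit_torus :
    ∃ c z : SpecialLinearGroup (Fin 2) K, z * z = 1 ∧ z * c * z⁻¹ = c⁻¹ ∧
      z ∉ Subgroup.zpowers c ∧
      (Subgroup.zpowers c).index = Nat.card K * (Nat.card K - 1) ∧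
      ∀ g, g ∉ Subgroup.zpowers c → z⁻¹ * g ∉ Subgroup.zpowers c →
        ∀ d ∈ Subgroup.zpowers c, g⁻¹ * d * g ∈ Subgroup.zpowers c → d = 1 :=
  exists_nonsplit_torus_of_extension (FiniteField.finrank_extension K 2 2)
    (FiniteField.Extension.frob K 2 2) fun _ => FiniteField.Extension.frob_apply K 2 2

end Matrix.SpecialLinearGroup

namespace Matrix.SpecialLinearGroup

variable {K F M : Type} [Field K] [CharP K 2] [Field F] [AddCommGroup M] [Module F M]
variable {ρ : Representation F (SpecialLinearGroup (Fin 2) K) M}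

theorem eq_one_of_upper (h : ∀ b, ρ (upper b) = 1) (g : SpecialLinearGroup (Fin 2) K) :
    ρ g = 1 := by
  have : ρ.ker = ⊤ := eq_top_of_normal (H := ρ.ker) h
  have hg : g ∈ ρ.ker := this ▸ Subgroup.mem_top g
  exact hg

variable [Finite K]

theorem exists_upper_eigenvector {b₀ : K} (hb₀ : ρ (upper b₀) ≠ 1) :
    ∃ (v : M) (ψ : K → F), v ≠ 0 ∧ ψ b₀ = -1 ∧ ∀ b, ρ (upper b) v = ψ b • v := by
  classical
  have := Fintype.ofFinite K
  have hadd : ∀ b b' v, ρ (upper b) (ρ (upper b') v) = ρ (upper (b + b')) v := fun b b' v => by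
    rw [← upper_mul, map_mul, Module.End.mul_apply]
  have hsq : ∀ b v, ρ (upper b) (ρ (upper b) v) = v := fun b v => by
    rw [hadd, CharTwo.add_self_eq_zero, upper_zero, map_one, Module.End.one_apply]
  have key : ∀ S : Finset K, ∃ (v : M) (ψ : K → F), v ≠ 0 ∧ ψ b₀ = -1 ∧
      ρ (upper b₀) v = - v ∧ ∀ b ∈ S, ρ (upper b) v = ψ b • v := by
    intro S
    induction S using Finset.induction_on with
    | empty =>
      obtain ⟨v, hv⟩ : ∃ v, ρ (upper b₀) v ≠ v := by
        by_contra! h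
        exact hb₀ (LinearMap.ext h)
      refine ⟨ρ (upper b₀) v - v, fun _ => -1, sub_ne_zero.2 hv, rfl, ?_, by simp⟩
      rw [map_sub, hsq, neg_sub]
    | insert b S hbS ih =>
      obtain ⟨v, ψ, hv, hψ, hv₀, hS⟩ := ih
      by_cases hb : b = b₀
      · refine ⟨v, ψ, hv, hψ, hv₀, fun b' hb' => ?_⟩
        rcases Finset.mem_insert.1 hb' with rfl | h
        · rw [hb, hψ, hv₀, neg_one_smul]
        · exact hS b' h
      by_cases h : ρ (upper b) v + v = 0
      · refine ⟨v, Function.update ψ b (-1), hv, by rw [Function.update_of_ne (Ne.symm hb), hψ],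
          hv₀, fun b' hb' => ?_⟩
        rcases Finset.mem_insert.1 hb' with rfl | h'
        · rw [Function.update_self, neg_one_smul, eq_neg_of_add_eq_zero_left h]
        · rw [Function.update_of_ne (by rintro rfl; exact hbS h'), hS b' h']
      · have hcomm : ∀ b' v, ρ (upper b') (ρ (upper b) v) = ρ (upper b) (ρ (upper b') v) :=
          fun b' v => by rw [hadd, hadd, add_comm]
        refine ⟨ρ (upper b) v + v, Function.update ψ b 1, h,
          by rw [Function.update_of_ne (Ne.symm hb), hψ], ?_, fun b' hb' => ?_⟩
        · rw [map_add, hcomm, hv₀, map_neg]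
          abel
        · rcases Finset.mem_insert.1 hb' with rfl | h'
          · rw [Function.update_self, one_smul, map_add, hsq, add_comm]
          · rw [Function.update_of_ne (by rintro rfl; exact hbS h'), map_add, hcomm, hS b' h',
              map_smul, smul_add]
  obtain ⟨v, ψ, h1, h2, -, h4⟩ := key Finset.univ
  exact ⟨v, ψ, h1, h2, fun b => h4 b (Finset.mem_univ b)⟩

theorem card_sub_one_le_finrank [NeZero (2 : F)] [FiniteDimensional F M]
    {b₀ : K} (hb₀ : ρ (upper b₀) ≠ 1) : Nat.card K - 1 ≤ Module.finrank F M := by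
  classical
  have := Fintype.ofFinite K
  obtain ⟨v, ψ, hv, hψ₀, hψ⟩ := exists_upper_eigenvector hb₀
  have hadd : ∀ b b', ψ (b + b') = ψ b * ψ b' := fun b b' => by
    have h := hψ (b + b')
    rw [← upper_mul, map_mul, Module.End.mul_apply, hψ, map_smul, hψ, smul_smul] at h
    rw [← smul_left_injective F hv h, mul_comm]
  have hzero : ψ 0 = 1 := by
    have h := hψ 0
    rw [upper_zero, map_one, Module.End.one_apply] at h
    exact smul_left_injective F hv (by simp only [← h, one_smul])
  let χ : Kˣ → (Multiplicative K →* F) := fun a =>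
    { toFun := fun b => ψ ((a : K) ^ 2 * b.toAdd)
      map_one' := by simp [hzero]
      map_mul' := fun b b' => by rw [toAdd_mul, mul_add, hadd] }
  have hχ : Function.Injective χ := by
    intro a a' h
    by_contra hne
    have hsum : (a : K) ^ 2 + (a' : K) ^ 2 ≠ 0 := by
      intro h0
      rw [← CharTwo.add_sq] at h0
      exact hne (Units.ext (CharTwo.add_eq_zero.1 (pow_eq_zero_iff two_ne_zero |>.1 h0)))
    let b := ((a : K) ^ 2 + (a' : K) ^ 2)⁻¹ * b₀
    have h1 : ψ ((a : K) ^ 2 * b) = ψ ((a' : K) ^ 2 * b) :=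
      congrArg (fun f : Multiplicative K →* F => f (Multiplicative.ofAdd b)) h
    have h2 : ψ b₀ = 1 := by
      have e : b₀ = (a : K) ^ 2 * b + (a' : K) ^ 2 * b := by
        rw [← add_mul, mul_inv_cancel_left₀ hsum]
      rw [e, hadd, h1, ← hadd, CharTwo.add_self_eq_zero, hzero]
    rw [hψ₀] at h2
    refine (two_ne_zero : (2 : F) ≠ 0) ?_
    linear_combination -h2
  let w : Kˣ → M := fun a => ρ (torus a⁻¹) v
  have hw : ∀ a b, ρ (upper b) (w a) = χ a (Multiplicative.ofAdd b) • w a := by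
    intro a b
    have e : upper b * torus a⁻¹ = torus a⁻¹ * upper ((a : K) ^ 2 * b) := by
      rw [torus_mul_upper]
      congr 2
      rw [← mul_assoc, ← mul_pow]
      simp
    simp only [w]
    rw [← Module.End.mul_apply, ← map_mul, e, map_mul, Module.End.mul_apply, hψ, map_smul]
    rfl
  have hw0 : ∀ a, w a ≠ 0 := by
    intro a h
    apply hv
    have := congrArg (ρ (torus a)) h
    simp only [w] at this
    rwa [← Module.End.mul_apply, ← map_mul, torus_mul, mul_inv_cancel,
      show torus (1 : Kˣ) = 1 from (torusHom K).map_one, map_one, map_zero] at this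
  have hli : LinearIndependent F w := by
    rw [Fintype.linearIndependent_iff]
    intro s hs a
    by_contra hsa
    obtain ⟨l, hl⟩ : ∃ l : Module.Dual F M, l (w a) ≠ 0 := by
      by_contra! h
      exact hw0 a ((Module.forall_dual_apply_eq_zero_iff F (w a)).1 h)
    have hded := (linearIndependent_monoidHom (Multiplicative K) F).comp χ hχ
    rw [Fintype.linearIndependent_iff] at hded
    have := hded (fun a => s a * l (w a)) (by
      funext b
      have h := congrArg (fun m => l (ρ (upper b.toAdd) m)) hs
      simp only [map_sum, map_smul, hw, map_zero] at h
      rw [Finset.sum_apply, Pi.zero_apply, ← h]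
      refine Finset.sum_congr rfl fun a _ => ?_
      simp only [Pi.smul_apply, Function.comp_apply, smul_eq_mul, ofAdd_toAdd]
      ring) a
    exact (mul_ne_zero hsa hl) this
  have := hli.fintype_card_le_finrank
  rwa [← Nat.card_eq_fintype_card, Nat.card_units] at this

theorem cross_characteristic_bound [NeZero (2 : F)] [IsAlgClosed F] [FiniteDimensional F M]
    [Nontrivial M]
    (hirred : ∀ P : Submodule F M,
      (∀ (g : SpecialLinearGroup (Fin 2) K) (x : M), x ∈ P → ρ g x ∈ P) → P = ⊥ ∨ P = ⊤) :
    (Nat.card K - 1) * Module.finrank F (groupCohomology (Rep.of ρ) 2) ≤ Module.finrank F M := by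
  have := Fintype.ofFinite K
  have h2 : (2 : F) ≠ 0 := two_ne_zero
  have hq : ((Nat.card K : ℕ) : F) ≠ 0 := by
    obtain ⟨n, -, hn⟩ := FiniteField.card K 2
    rw [Nat.card_eq_fintype_card, hn]
    push_cast
    exact pow_ne_zero _ h2
  have hq1 : 1 < Nat.card K := Finite.one_lt_card
  obtain ⟨c, z, hzz, hzc, hz, hidx, hTI⟩ : ∃ c z : SpecialLinearGroup (Fin 2) K,
      z * z = 1 ∧ z * c * z⁻¹ = c⁻¹ ∧ z ∉ Subgroup.zpowers c ∧
      ((Subgroup.zpowers c).index : F) ≠ 0 ∧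
      ∀ g, g ∉ Subgroup.zpowers c → z⁻¹ * g ∉ Subgroup.zpowers c →
        ∀ d ∈ Subgroup.zpowers c, g⁻¹ * d * g ∈ Subgroup.zpowers c → d = 1 := by
    by_cases h : ((Nat.card K + 1 : ℕ) : F) = 0
    · obtain ⟨c, z, h1, h2', h3, h4, h5⟩ := exists_nonsplit_torus (K := K)
      refine ⟨c, z, h1, h2', h3, ?_, h5⟩
      rw [h4, Nat.cast_mul]
      refine mul_ne_zero hq fun h0 => h2 ?_
      rw [Nat.cast_sub hq1.le] at h0
      push_cast at h h0
      linear_combination h - h0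
    · obtain ⟨a, ha⟩ := IsCyclic.exists_generator (α := Kˣ)
      refine ⟨torus a, weyl K, weyl_mul_weyl, ?_, ?_, ?_,
        fun g hg hwg d hd => torus_trivial_intersection ha hg hwg hd⟩
      · rw [weyl_mul_torus, mul_inv_cancel_right]
        exact (torusHom K).map_inv a
      · rw [mem_zpowers_torus ha]
        simp [coe_weyl]
      · rw [index_zpowers_torus ha, Nat.cast_mul]
        exact mul_ne_zero hq h
  by_cases htriv : ∀ b, ρ (upper b) = 1
  · rw [Representation.finrank_H2_eq_zero_of_coboundary ρ fun f hf =>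
      Representation.isTwoCoboundaryOn_top_of_map_eq hf hzc
        (fun v => by rw [eq_one_of_upper htriv]; rfl) hidx]
    simp
  · push Not at htriv
    obtain ⟨b₀, hb₀⟩ := htriv
    refine le_trans ?_ (card_sub_one_le_finrank hb₀)
    exact mul_le_of_le_one_right (Nat.zero_le _)
      (Representation.finrank_H2_le_one_of_dihedral hirred hzz hzc hz hidx hTI)

end Matrix.SpecialLinearGroup

namespace FrobeniusMonomial

variable {K F : Type} [Field K] [Field F] {e : ℕ}

/-- The product of the Frobenius twists `x ↦ ι x ^ 2 ^ j` over `j ∈ C`. -/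
def mon (ι : K →+* F) (C : Finset (Fin e)) (x : K) : F :=
  ∏ j ∈ C, ι x ^ 2 ^ (j : ℕ)

variable (ι : K →+* F)

theorem mon_eq_pow (C : Finset (Fin e)) (x : K) :
    mon ι C x = ι x ^ ∑ j ∈ C.map Fin.valEmbedding, 2 ^ j := by
  rw [mon, Finset.prod_pow_eq_pow_sum, Finset.sum_map]
  rfl

theorem mon_empty (x : K) : mon ι (∅ : Finset (Fin e)) x = 1 := Finset.prod_empty

theorem mon_zero {C : Finset (Fin e)} (hC : C.Nonempty) : mon ι C 0 = 0 := by
  obtain ⟨j, hj⟩ := hC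
  exact Finset.prod_eq_zero hj (by simp)

theorem mon_mul (C : Finset (Fin e)) (a x : K) : mon ι C (a * x) = mon ι C a * mon ι C x := by
  simp only [mon, map_mul, mul_pow, Finset.prod_mul_distrib]

theorem mon_singleton (j : Fin e) (x : K) : mon ι {j} x = ι x ^ 2 ^ (j : ℕ) :=
  Finset.prod_singleton _ _

theorem mon_insert {C : Finset (Fin e)} {j : Fin e} (hj : j ∉ C) (x : K) :
    mon ι (insert j C) x = mon ι {j} x * mon ι C x := by
  rw [mon_singleton]
  exact Finset.prod_insert hj

theorem mon_add [CharP F 2] (C : Finset (Fin e)) (x b : K) :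
    mon ι C (x + b) = ∑ D ∈ C.powerset, mon ι D b * mon ι (C \ D) x := by
  simp only [mon, map_add, add_pow_char_pow]
  simp only [add_comm (ι x ^ _)]
  exact Finset.prod_add _ _ _

theorem linearIndependent_mon [Finite K] (hK : Nat.card K = 2 ^ e) :
    LinearIndependent F (mon ι : Finset (Fin e) → K → F) := by
  classical
  have := Fintype.ofFinite K
  rw [Fintype.linearIndependent_iff]
  intro s hs
  let n : Finset (Fin e) → ℕ := fun C => ∑ j ∈ C.map Fin.valEmbedding, 2 ^ j
  have hn : Function.Injective n :=
    (Finset.geomSum_injective le_rfl).comp (Finset.map_injective _)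
  have hlt : ∀ C, n C < 2 ^ e := fun C => Nat.geomSum_lt le_rfl (by
    intro k hk
    obtain ⟨j, -, rfl⟩ := Finset.mem_map.1 hk
    exact j.2)
  let p : Polynomial F := ∑ C, Polynomial.monomial (n C) (s C)
  have hcoeff : ∀ C, p.coeff (n C) = s C := by
    intro C
    simp only [p, Polynomial.finsetSum_coeff, Polynomial.coeff_monomial]
    rw [Finset.sum_eq_single C (fun D _ hD => if_neg fun h => hD (hn h))
      (fun h => absurd (Finset.mem_univ C) h), if_pos rfl]
  have hp : p = 0 := by
    refine Polynomial.eq_zero_of_natDegree_lt_card_of_eval_eq_zero p ι.injective ?_ ?_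
    · intro x
      have := congrFun hs x
      simp only [Finset.sum_apply, Pi.smul_apply, Pi.zero_apply, smul_eq_mul, mon_eq_pow] at this
      rw [Polynomial.eval_finsetSum, ← this]
      refine Finset.sum_congr rfl fun C _ => ?_
      rw [Polynomial.eval_monomial]
    · rw [← Nat.card_eq_fintype_card, hK]
      refine lt_of_le_of_lt (Polynomial.natDegree_sum_le_of_forall_le (n := 2 ^ e - 1) _ _ ?_)
        (Nat.sub_lt (by positivity) one_pos)
      intro C _
      exact (Polynomial.natDegree_monomial_le _).trans (Nat.le_sub_one_of_lt (hlt C))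
  intro C
  rw [← hcoeff, hp, Polynomial.coeff_zero]

theorem mon_injective [Finite K] (hK : Nat.card K = 2 ^ e) :
    Function.Injective (mon ι : Finset (Fin e) → K → F) :=
  (linearIndependent_mon ι hK).injective

theorem eq_of_mon_eq [Finite K] (hK : Nat.card K = 2 ^ e) {C D : Finset (Fin e)}
    (hC : C.Nonempty) (hD : D.Nonempty) (h : ∀ a : Kˣ, mon ι C (a : K) = mon ι D (a : K)) :
    C = D := by
  refine mon_injective ι hK (funext fun x => ?_)
  by_cases hx : x = 0
  · rw [hx, mon_zero ι hC, mon_zero ι hD]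
  · exact h (Units.mk0 x hx)

theorem mon_univ [Finite K] (hK : Nat.card K = 2 ^ e) (a : Kˣ) :
    mon ι (Finset.univ : Finset (Fin e)) (a : K) = 1 := by
  have := Fintype.ofFinite K
  rw [mon, Finset.prod_pow_eq_pow_sum, Fin.sum_univ_eq_sum_range (fun j => 2 ^ j),
    Nat.geomSum_eq le_rfl, ← hK, Nat.card_eq_fintype_card, ← map_pow]
  norm_num
  rw [← map_pow, FiniteField.pow_card_sub_one_eq_one _ a.ne_zero, map_one]

variable (F) in
/-- Translation of functions on `K`. -/
def translate (b : K) : (K → F) →ₗ[F] (K → F) := LinearMap.funLeft F F (· + b)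

variable (F) in
/-- Dilation of functions on `K`. -/
def dilate (a : K) : (K → F) →ₗ[F] (K → F) := LinearMap.funLeft F F (a * ·)

theorem translate_apply (b : K) (φ : K → F) (x : K) : translate F b φ x = φ (x + b) := rfl

theorem dilate_apply (a : K) (φ : K → F) (x : K) : dilate F a φ x = φ (a * x) := rfl

theorem dilate_mon (a : K) (C : Finset (Fin e)) :
    dilate F a (mon ι C) = mon ι C a • mon ι C := by
  funext x
  rw [dilate_apply, mon_mul]
  rfl

theorem eq_const_of_translate {φ : K → F} (h : ∀ b, translate F b φ = φ) (x : K) :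
    φ x = φ 0 := by
  have := congrFun (h x) 0
  rwa [translate_apply, zero_add] at this

variable [Finite K] (hK : Nat.card K = 2 ^ e)

/-- The basis of the space of functions on `K` consisting of the Frobenius monomials. -/
noncomputable def basis : Module.Basis (Finset (Fin e)) F (K → F) :=
  letI := Fintype.ofFinite K
  basisOfLinearIndependentOfCardEqFinrank (linearIndependent_mon ι hK) (by
    rw [Module.finrank_fintype_fun_eq_card, Fintype.card_finset, Fintype.card_fin, ← hK,
      Nat.card_eq_fintype_card])

theorem basis_apply (C : Finset (Fin e)) : basis ι hK C = mon ι C := by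
  simp [basis]

/-- Division by the monomial of `D`, where monomials not divisible by it are sent to zero. -/
noncomputable def divide (D : Finset (Fin e)) : (K → F) →ₗ[F] (K → F) :=
  (basis ι hK).constr F fun C => if D ⊆ C then mon ι (C \ D) else 0

theorem divide_mon (D C : Finset (Fin e)) :
    divide ι hK D (mon ι C) = if D ⊆ C then mon ι (C \ D) else 0 := by
  rw [← basis_apply ι hK C, divide, Module.Basis.constr_basis]

/-- Multiplication by the `j`-th Frobenius twist, truncated at its square. -/
noncomputable def raise (j : Fin e) : (K → F) →ₗ[F] (K → F) :=
  (basis ι hK).constr F fun C => if j ∈ C then 0 else mon ι (insert j C)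

theorem raise_mon (j : Fin e) (C : Finset (Fin e)) :
    raise ι hK j (mon ι C) = if j ∈ C then 0 else mon ι (insert j C) := by
  rw [← basis_apply ι hK C, raise, Module.Basis.constr_basis]

theorem ext_mon (hK : Nat.card K = 2 ^ e) {V : Type} [AddCommGroup V] [Module F V]
    {f g : (K → F) →ₗ[F] V}
    (h : ∀ C : Finset (Fin e), f (mon ι C) = g (mon ι C)) : f = g :=
  (basis ι hK).ext fun C => by rw [basis_apply, h]

/-- Division by a single Frobenius twist. -/
noncomputable def lower (j : Fin e) : (K → F) →ₗ[F] (K → F) := divide ι hK {j}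

theorem lower_mon (j : Fin e) (C : Finset (Fin e)) :
    lower ι hK j (mon ι C) = if j ∈ C then mon ι (C.erase j) else 0 := by
  simp only [lower, divide_mon, Finset.singleton_subset_iff, Finset.sdiff_singleton_eq_erase]

theorem lower_lower (j : Fin e) (φ : K → F) : lower ι hK j (lower ι hK j φ) = 0 := by
  have : lower ι hK j ∘ₗ lower ι hK j = 0 := ext_mon ι hK fun C => by
    rw [LinearMap.comp_apply, lower_mon, LinearMap.zero_apply]
    split_ifs
    · rw [lower_mon, if_neg (Finset.notMem_erase j C)]
    · rw [map_zero]
  exact LinearMap.congr_fun this φ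

theorem lower_comm (i j : Fin e) (φ : K → F) :
    lower ι hK i (lower ι hK j φ) = lower ι hK j (lower ι hK i φ) := by
  by_cases hij : i = j
  · rw [hij]
  have : lower ι hK i ∘ₗ lower ι hK j = lower ι hK j ∘ₗ lower ι hK i := ext_mon ι hK fun C => by
    simp only [LinearMap.comp_apply, lower_mon, apply_ite (lower ι hK i),
      apply_ite (lower ι hK j), map_zero, Finset.mem_erase, Finset.erase_right_comm (a := i)]
    split_ifs <;> tauto
  exact LinearMap.congr_fun this φ

theorem lower_raise_self (j : Fin e) (φ : K → F) :
    lower ι hK j (raise ι hK j φ) + raise ι hK j (lower ι hK j φ) = φ := by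
  have : lower ι hK j ∘ₗ raise ι hK j + raise ι hK j ∘ₗ lower ι hK j = LinearMap.id :=
    ext_mon ι hK fun C => by
      by_cases hj : j ∈ C
      · simp [lower_mon, raise_mon, hj, Finset.insert_erase]
      · simp [lower_mon, raise_mon, hj]
  exact LinearMap.congr_fun this φ

theorem lower_raise_of_ne {i j : Fin e} (hij : i ≠ j) (φ : K → F) :
    lower ι hK i (raise ι hK j φ) = raise ι hK j (lower ι hK i φ) := by
  have : lower ι hK i ∘ₗ raise ι hK j = raise ι hK j ∘ₗ lower ι hK i := ext_mon ι hK fun C => by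
    by_cases hi : i ∈ C <;> by_cases hj : j ∈ C <;>
      simp [lower_mon, raise_mon, hi, hj, hij, hij.symm, Finset.erase_insert_of_ne]
  exact LinearMap.congr_fun this φ

theorem translate_eq [CharP F 2] (b : K) (φ : K → F) :
    translate F b φ = ∑ D, mon ι D b • divide ι hK D φ := by
  have : translate F b = ∑ D, mon ι D b • divide ι hK D := ext_mon ι hK fun C => by
    rw [LinearMap.sum_apply]
    simp only [LinearMap.smul_apply, divide_mon, smul_ite, smul_zero]
    rw [← Finset.sum_filter]
    funext x
    rw [translate_apply, mon_add, Finset.sum_apply]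
    exact Finset.sum_congr (by ext; simp) fun D _ => rfl
  rw [this, LinearMap.sum_apply]
  rfl

theorem lower_translate [CharP F 2] (j : Fin e) (b : K) (φ : K → F) :
    lower ι hK j (translate F b φ) = translate F b (lower ι hK j φ) := by
  have hcomm : ∀ D, lower ι hK j ∘ₗ divide ι hK D = divide ι hK D ∘ₗ lower ι hK j := fun D =>
    ext_mon ι hK fun C => by
      simp only [LinearMap.comp_apply, lower_mon, divide_mon]
      by_cases hD : D ⊆ C <;> by_cases hj : j ∈ C
      · by_cases hjD : j ∈ D
        · simp only [hD, hj, if_true, lower_mon, divide_mon]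
          rw [if_neg (by simp [hjD]), if_neg (fun h => Finset.notMem_erase j C (h hjD))]
        · simp only [hD, hj, if_true, lower_mon, divide_mon]
          rw [if_pos (by simp [hj, hjD]), if_pos (Finset.subset_erase.2 ⟨hD, hjD⟩)]
          congr 1
          ext
          simp
          tauto
      · simp [hD, hj, lower_mon]
      · simp only [hD, hj, if_true, if_false, divide_mon, map_zero]
        rw [if_neg fun h => hD (h.trans (Finset.erase_subset _ _))]
      · simp [hD, hj]
  rw [translate_eq ι hK, translate_eq ι hK, map_sum]
  refine Finset.sum_congr rfl fun D _ => ?_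
  rw [map_smul]
  congr 1
  exact LinearMap.congr_fun (hcomm D) φ

theorem lower_dilate (j : Fin e) (a : K) (φ : K → F) :
    lower ι hK j (dilate F a φ) = mon ι {j} a • dilate F a (lower ι hK j φ) := by
  have : lower ι hK j ∘ₗ dilate F a = mon ι {j} a • dilate F a ∘ₗ lower ι hK j :=
    ext_mon ι hK fun C => by
      simp only [LinearMap.comp_apply, LinearMap.smul_apply, dilate_mon, map_smul, lower_mon]
      split_ifs with h
      · rw [dilate_mon, smul_smul, ← mon_insert ι (Finset.notMem_erase j C),
          Finset.insert_erase h]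
      · simp
  exact LinearMap.congr_fun this φ

theorem lower_const (j : Fin e) (t : F) : lower ι hK j (fun _ => t) = 0 := by
  have : (fun _ => t : K → F) = t • mon ι (∅ : Finset (Fin e)) := by
    funext x
    simp [mon_empty]
  rw [this, map_smul, lower_mon]
  simp

/-- A translation invariant subspace is stable under division by monomials. -/
theorem divide_mem [CharP F 2] {P : Submodule F (K → F)}
    (hP : ∀ b, ∀ φ ∈ P, translate F b φ ∈ P) (D : Finset (Fin e)) {φ : K → F} (hφ : φ ∈ P) :
    divide ι hK D φ ∈ P := by
  have := Fintype.ofFinite K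
  by_contra hcon
  obtain ⟨l, hl, hlP⟩ := Submodule.exists_dual_map_eq_bot_of_notMem hcon inferInstance
  have hl0 : ∀ v ∈ P, l v = 0 := fun v hv =>
    (Submodule.mem_bot F).1 (hlP ▸ Submodule.mem_map_of_mem hv)
  have hli := linearIndependent_mon ι hK
  rw [Fintype.linearIndependent_iff] at hli
  refine hl (hli (fun D => l (divide ι hK D φ)) (funext fun b => ?_) D)
  have h := hl0 _ (hP b φ hφ)
  rw [translate_eq ι hK, map_sum] at h
  rw [Finset.sum_apply, Pi.zero_apply, ← h]
  refine Finset.sum_congr rfl fun D _ => ?_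
  rw [map_smul, Pi.smul_apply, smul_eq_mul, smul_eq_mul, mul_comm]

end FrobeniusMonomial

namespace FrobeniusMonomial

open Matrix.SpecialLinearGroup

section Koszul

variable {K F : Type} [Field K] [Field F] {e : ℕ}

theorem translate_translate (a b : K) (φ : K → F) :
    translate F a (translate F b φ) = translate F (a + b) φ := by
  funext x
  simp only [translate_apply, add_assoc]

variable (ι : K →+* F) [Finite K] (hK : Nat.card K = 2 ^ e)

theorem exists_lower_eq (S : Finset (Fin e)) (s : Fin e → K → F)
    (h₀ : ∀ a ∈ S, lower ι hK a (s a) = 0)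
    (h₁ : ∀ a ∈ S, ∀ c ∈ S, lower ι hK c (s a) = lower ι hK a (s c)) :
    ∃ t, ∀ a ∈ S, lower ι hK a t = s a := by
  induction S using Finset.induction_on with
  | empty => exact ⟨0, by simp⟩
  | insert a₀ S ha₀ ih =>
    obtain ⟨t, ht⟩ := ih (fun a ha => h₀ a (Finset.mem_insert_of_mem ha))
      fun a ha c hc => h₁ a (Finset.mem_insert_of_mem ha) c (Finset.mem_insert_of_mem hc)
    refine ⟨t + raise ι hK a₀ (s a₀ - lower ι hK a₀ t), fun a ha => ?_⟩
    rcases Finset.mem_insert.1 ha with rfl | haS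
    · have := lower_raise_self ι hK a (s a - lower ι hK a t)
      rw [map_sub (lower ι hK a), lower_lower, h₀ a ha, sub_zero, map_zero, add_zero] at this
      rw [map_add, this, add_sub_cancel]
    · have hne : a ≠ a₀ := by
        rintro rfl
        exact ha₀ haS
      rw [map_add, lower_raise_of_ne ι hK hne, map_sub (lower ι hK a), lower_comm, ht a haS,
        h₁ a₀ (Finset.mem_insert_self _ _) a ha, sub_self, map_zero, add_zero]

end Koszul

variable {K F M : Type} [Field K] [Field F] [AddCommGroup M] [Module F M] {e : ℕ}

section Obstruction

variable (π : M →ₗ[F] (K → F))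

/-- The cochain obtained from `f` by evaluating the last coefficient map at `0`. -/
def cochain :
    (Matrix.SpecialLinearGroup (Fin 2) K → Matrix.SpecialLinearGroup (Fin 2) K → M) →ₗ[F]
      (K → K → F) where
  toFun f h x := π (f (upper x) (upper h)) 0
  map_add' f₁ f₂ := by
    funext h x
    simp
  map_smul' c f := by
    funext h x
    simp

variable {π} in
theorem cochain_apply
    (f : Matrix.SpecialLinearGroup (Fin 2) K → Matrix.SpecialLinearGroup (Fin 2) K → M) (h x : K) :
    cochain π f h x = π (f (upper x) (upper h)) 0 := rfl

variable (ι : K →+* F) [Finite K] (hK : Nat.card K = 2 ^ e)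

/-- A primitive of the derivative of the cochain of `f` in the direction `a`. -/
noncomputable def slope (a : Fin e) :
    (Matrix.SpecialLinearGroup (Fin 2) K → Matrix.SpecialLinearGroup (Fin 2) K → M) →ₗ[F]
      (K → F) where
  toFun f x := lower ι hK a (cochain π f x) 0
  map_add' f₁ f₂ := by
    funext x
    simp
  map_smul' c f := by
    funext x
    simp

/-- The obstruction to triviality of `f` on the group of upper unitriangular matrices. -/
noncomputable def obstruction (a c : Fin e) :
    (Matrix.SpecialLinearGroup (Fin 2) K → Matrix.SpecialLinearGroup (Fin 2) K → M) →ₗ[F] F where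
  toFun f := if a = c then lower ι hK a (slope π ι hK a f) 0 else
    lower ι hK c (slope π ι hK a f) 0 - lower ι hK a (slope π ι hK c f) 0
  map_add' f₁ f₂ := by
    split_ifs
    · simp
    · simp only [map_add, Pi.add_apply]
      ring
  map_smul' c f := by
    split_ifs
    · simp
    · simp only [map_smul, Pi.smul_apply, smul_eq_mul, RingHom.id_apply]
      ring

variable {π}

theorem slope_apply (a : Fin e)
    (f : Matrix.SpecialLinearGroup (Fin 2) K → Matrix.SpecialLinearGroup (Fin 2) K → M) (x : K) :
    slope π ι hK a f x = lower ι hK a (cochain π f x) 0 := rfl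

theorem obstruction_self (a : Fin e)
    (f : Matrix.SpecialLinearGroup (Fin 2) K → Matrix.SpecialLinearGroup (Fin 2) K → M) :
    obstruction π ι hK a a f = lower ι hK a (slope π ι hK a f) 0 := if_pos rfl

theorem obstruction_of_ne {a c : Fin e} (hac : a ≠ c)
    (f : Matrix.SpecialLinearGroup (Fin 2) K → Matrix.SpecialLinearGroup (Fin 2) K → M) :
    obstruction π ι hK a c f =
      lower ι hK c (slope π ι hK a f) 0 - lower ι hK a (slope π ι hK c f) 0 := if_neg hac

theorem obstruction_symm {a c : Fin e} (hac : a ≠ c)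
    (f : Matrix.SpecialLinearGroup (Fin 2) K → Matrix.SpecialLinearGroup (Fin 2) K → M) :
    obstruction π ι hK c a f = -obstruction π ι hK a c f := by
  rw [obstruction_of_ne ι hK hac, obstruction_of_ne ι hK hac.symm, neg_sub]

end Obstruction

/-- `π` identifies `ρ` with the space of functions on `K` spanned by the Frobenius monomials
of the subsets of `I`. -/
structure IsMonomialModel (ρ : Representation F (Matrix.SpecialLinearGroup (Fin 2) K) M)
    (ι : K →+* F) [Finite K] (hK : Nat.card K = 2 ^ e) (I : Finset (Fin e))
    (π : M →ₗ[F] (K → F)) : Prop where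
  injective : Function.Injective π
  map_upper : ∀ b m, π (ρ (upper b) m) = translate F b (π m)
  map_torus : ∀ (κ : Kˣ) m,
    π (ρ (torus κ) m) = mon ι I (κ : K) • dilate F (((κ⁻¹ : Kˣ) : K) ^ 2) (π m)
  mem_range_iff : ∀ φ, (∃ m, π m = φ) ↔ ∀ a ∉ I, lower ι hK a φ = 0

namespace IsMonomialModel

variable {ρ : Representation F (Matrix.SpecialLinearGroup (Fin 2) K) M} {ι : K →+* F} [Finite K]
  {hK : Nat.card K = 2 ^ e} {I : Finset (Fin e)} {π : M →ₗ[F] (K → F)}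
  {f : Matrix.SpecialLinearGroup (Fin 2) K → Matrix.SpecialLinearGroup (Fin 2) K → M}

theorem lower_eq_zero (hπ : IsMonomialModel ρ ι hK I π) {a : Fin e} (ha : a ∉ I) (m : M) :
    lower ι hK a (π m) = 0 :=
  (hπ.mem_range_iff _).1 ⟨m, rfl⟩ a ha

theorem map_cocycle (hπ : IsMonomialModel ρ ι hK I π) (hf : ρ.IsTwoCocycle f) (h j : K) :
    π (f (upper h) (upper j)) =
      translate F h (cochain π f j) - cochain π f (h + j) + cochain π f h := by
  funext x
  have := congrArg (fun m => π m 0) (hf (upper x) (upper h) (upper j))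
  simp only [map_add, Pi.add_apply, upper_mul, hπ.map_upper, translate_apply, zero_add] at this
  simp only [Pi.add_apply, Pi.sub_apply, translate_apply, cochain_apply]
  linear_combination -this

variable [CharP F 2]

theorem lower_cochain (hπ : IsMonomialModel ρ ι hK I π) (hf : ρ.IsTwoCocycle f) {a : Fin e}
    (ha : a ∉ I) (j : K) :
    lower ι hK a (cochain π f j) =
      translate F j (slope π ι hK a f) - slope π ι hK a f := by
  funext h
  have := congrFun (congrArg (lower ι hK a) (hπ.map_cocycle hf h j)) 0
  rw [hπ.lower_eq_zero ha, map_add, map_sub, lower_translate] at this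
  simp only [Pi.add_apply, Pi.sub_apply, translate_apply, zero_add, Pi.zero_apply] at this
  simp only [Pi.sub_apply, translate_apply, slope_apply]
  linear_combination -this

theorem lower_slope_self (hπ : IsMonomialModel ρ ι hK I π) (hf : ρ.IsTwoCocycle f) {a : Fin e}
    (ha : a ∉ I) (x : K) :
    lower ι hK a (slope π ι hK a f) x = obstruction π ι hK a a f := by
  rw [obstruction_self]
  refine eq_const_of_translate (fun b => ?_) x
  have := congrArg (lower ι hK a) (hπ.lower_cochain hf ha b)
  rw [lower_lower, map_sub, lower_translate] at this
  exact (sub_eq_zero.1 this.symm)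

theorem lower_slope_sub (hπ : IsMonomialModel ρ ι hK I π) (hf : ρ.IsTwoCocycle f) {a c : Fin e}
    (ha : a ∉ I) (hc : c ∉ I) (hac : a ≠ c) (x : K) :
    lower ι hK c (slope π ι hK a f) x - lower ι hK a (slope π ι hK c f) x =
      obstruction π ι hK a c f := by
  rw [obstruction_of_ne ι hK hac]
  refine eq_const_of_translate (φ := lower ι hK c (slope π ι hK a f) -
    lower ι hK a (slope π ι hK c f)) (fun b => ?_) x
  have h₁ := congrArg (lower ι hK c) (hπ.lower_cochain hf ha b)
  have h₂ := congrArg (lower ι hK a) (hπ.lower_cochain hf hc b)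
  rw [lower_comm, h₂] at h₁
  simp only [map_sub, lower_translate] at h₁ ⊢
  linear_combination -h₁

theorem isTwoCoboundaryOn_of_obstruction_eq_zero (hπ : IsMonomialModel ρ ι hK I π)
    (hf : ρ.IsTwoCocycle f) (h : ∀ a ∉ I, ∀ c ∉ I, obstruction π ι hK a c f = 0) :
    ρ.IsTwoCoboundaryOn (upperHom K).range f := by
  obtain ⟨t, ht⟩ := exists_lower_eq ι hK Iᶜ (fun a => slope π ι hK a f)
    (fun a ha => by
      rw [Finset.mem_compl] at ha
      funext x
      rw [hπ.lower_slope_self hf ha, h a ha a ha, Pi.zero_apply])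
    (fun a ha c hc => by
      rw [Finset.mem_compl] at ha hc
      by_cases hac : a = c
      · rw [hac]
      funext x
      exact sub_eq_zero.1 ((hπ.lower_slope_sub hf ha hc hac x).trans (h a ha c hc)))
  have hα : ∀ b, ∃ m, π m = cochain π f b - (translate F b t - t) := by
    intro b
    refine (hπ.mem_range_iff _).2 fun a ha => ?_
    simp only [map_sub, lower_translate, hπ.lower_cochain hf ha, ht a (Finset.mem_compl.2 ha),
      sub_self]
  choose α hα using hα
  refine ⟨Function.extend upper α 0, ?_⟩
  rintro _ ⟨x, rfl⟩ _ ⟨y, rfl⟩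
  change f (upper x.toAdd) (upper y.toAdd) = ρ (upper x.toAdd) (Function.extend upper α 0
    (upper y.toAdd)) - Function.extend upper α 0 (upper x.toAdd * upper y.toAdd) +
      Function.extend upper α 0 (upper x.toAdd)
  rw [upper_mul, upper_injective.extend_apply, upper_injective.extend_apply,
    upper_injective.extend_apply]
  refine hπ.injective ?_
  rw [hπ.map_cocycle hf, map_add, map_sub, hπ.map_upper, hα, hα, hα, map_sub, map_sub,
    translate_translate]
  abel

omit [CharP F 2] in
theorem cochain_of_coboundary (hπ : IsMonomialModel ρ ι hK I π)
    {α : Matrix.SpecialLinearGroup (Fin 2) K → M} (h : K) :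
    cochain π (fun g h => ρ g (α h) - α (g * h) + α g) h = π (α (upper h)) -
      (translate F h (fun x => π (α (upper x)) 0) - fun x => π (α (upper x)) 0) := by
  funext x
  simp only [cochain_apply, map_add, map_sub, hπ.map_upper, upper_mul, Pi.add_apply, Pi.sub_apply,
    translate_apply, zero_add]
  ring

theorem obstruction_of_coboundary (hπ : IsMonomialModel ρ ι hK I π)
    (α : Matrix.SpecialLinearGroup (Fin 2) K → M) {a c : Fin e} (ha : a ∉ I) (hc : c ∉ I) :
    obstruction π ι hK a c (fun g h => ρ g (α h) - α (g * h) + α g) = 0 := by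
  have key : ∀ a ∉ I, slope π ι hK a (fun g h => ρ g (α h) - α (g * h) + α g) =
      (fun _ => lower ι hK a (fun x => π (α (upper x)) 0) 0) -
        lower ι hK a fun x => π (α (upper x)) 0 := by
    intro a ha
    funext x
    rw [slope_apply, hπ.cochain_of_coboundary, map_sub, map_sub, hπ.lower_eq_zero ha,
      lower_translate]
    simp only [Pi.sub_apply, translate_apply, Pi.zero_apply, zero_add]
    ring
  by_cases hac : a = c
  · subst hac
    rw [obstruction_self, key a ha, map_sub, lower_const, lower_lower]
    simp
  · rw [obstruction_of_ne ι hK hac, key a ha, key c hc, map_sub, map_sub, lower_const,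
      lower_const, lower_comm ι hK a c]
    simp

omit [CharP F 2] in
theorem obstruction_conj (hπ : IsMonomialModel ρ ι hK I π) (κ : Kˣ) (a c : Fin e) :
    obstruction π ι hK a c
      (fun g h => ρ (torus κ) (f ((torus κ)⁻¹ * g * torus κ) ((torus κ)⁻¹ * h * torus κ))) =
      mon ι I (κ : K) * (mon ι {a} (((κ⁻¹ : Kˣ) : K) ^ 2) *
        mon ι {c} (((κ⁻¹ : Kˣ) : K) ^ 2)) * obstruction π ι hK a c f := by
  set f' := fun g h =>
    ρ (torus κ) (f ((torus κ)⁻¹ * g * torus κ) ((torus κ)⁻¹ * h * torus κ)) with hf'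
  have hu : ∀ x : K, (torus κ)⁻¹ * upper x * torus κ = upper (((κ⁻¹ : Kˣ) : K) ^ 2 * x) := by
    intro x
    rw [mul_assoc, inv_mul_eq_iff_eq_mul, torus_mul_upper]
    congr 2
    rw [← mul_assoc, ← mul_pow, Units.mul_inv, one_pow, one_mul]
  have hβ : ∀ h, cochain π f' h = mon ι I (κ : K) •
      dilate F (((κ⁻¹ : Kˣ) : K) ^ 2) (cochain π f (((κ⁻¹ : Kˣ) : K) ^ 2 * h)) := by
    intro h
    funext x
    simp only [cochain_apply, hf', hu, hπ.map_torus, Pi.smul_apply, dilate_apply, mul_zero]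
  have hs : ∀ a, slope π ι hK a f' = (mon ι I (κ : K) * mon ι {a} (((κ⁻¹ : Kˣ) : K) ^ 2)) •
      dilate F (((κ⁻¹ : Kˣ) : K) ^ 2) (slope π ι hK a f) := by
    intro a
    funext x
    simp only [slope_apply, hβ, map_smul, lower_dilate, Pi.smul_apply, dilate_apply, mul_zero,
      smul_smul]
  by_cases hac : a = c
  · subst hac
    simp only [obstruction_self, hs, map_smul, lower_dilate, Pi.smul_apply, dilate_apply,
      mul_zero, smul_eq_mul]
    ring
  · simp only [obstruction_of_ne ι hK hac, hs, map_smul, lower_dilate, Pi.smul_apply,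
      dilate_apply, mul_zero, smul_eq_mul]
    ring

theorem weight_of_obstruction_ne_zero (hπ : IsMonomialModel ρ ι hK I π) (hf : ρ.IsTwoCocycle f)
    {a c : Fin e} (ha : a ∉ I) (hc : c ∉ I) (h : obstruction π ι hK a c f ≠ 0) (κ : Kˣ) :
    mon ι {a} ((κ : K) ^ 2) * mon ι {c} ((κ : K) ^ 2) = mon ι I (κ : K) := by
  obtain ⟨α, hα⟩ := hf.conj_sub (torus κ)
  have h₀ := hπ.obstruction_of_coboundary α ha hc
  have h₁ : (fun g h => ρ g (α h) - α (g * h) + α g) = (fun g h => ρ (torus κ)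
      (f ((torus κ)⁻¹ * g * torus κ) ((torus κ)⁻¹ * h * torus κ))) - f := by
    funext g h
    exact (hα g h).symm
  rw [h₁, map_sub, hπ.obstruction_conj, sub_eq_zero] at h₀
  have h₂ := mul_right_cancel₀ h (h₀.trans (one_mul _).symm)
  have hinv : ∀ a : Fin e,
      mon ι {a} ((κ : K) ^ 2) * mon ι {a} (((κ⁻¹ : Kˣ) : K) ^ 2) = 1 := by
    intro a
    rw [← mon_mul, ← mul_pow, Units.mul_inv, mon_singleton]
    simp
  linear_combination (mon ι I (κ : K)) * (mon ι {a} ((κ : K) ^ 2) *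
    mon ι {a} (((κ⁻¹ : Kˣ) : K) ^ 2)) * hinv c + mon ι I (κ : K) * hinv a -
    mon ι {a} ((κ : K) ^ 2) * mon ι {c} ((κ : K) ^ 2) * h₂

end IsMonomialModel

end FrobeniusMonomial

namespace FrobeniusMonomial

open Matrix.SpecialLinearGroup

variable {K F : Type} [Field K] [Field F] {e : ℕ}

theorem mon_sq (ι : K →+* F) (C : Finset (Fin e)) (x : K) : mon ι C (x ^ 2) = mon ι C x ^ 2 := by
  rw [sq, mon_mul, sq]

theorem mon_eq_of_sq_eq [CharP F 2] (ι : K →+* F) {C D : Finset (Fin e)} {x : K}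
    (h : mon ι C x ^ 2 = mon ι D x ^ 2) : mon ι C x = mon ι D x :=
  frobenius_inj F 2 h

theorem exists_sq_eq [Finite K] [CharP K 2] (x : Kˣ) : ∃ y : Kˣ, (y : K) ^ 2 = x := by
  obtain ⟨y, hy⟩ := ((frobenius_inj K 2).bijective_of_finite).2 (x : K)
  have hy' : y ^ 2 = x := hy
  have hy0 : y ≠ 0 := by
    rintro rfl
    exact x.ne_zero (by rw [← hy']; simp)
  exact ⟨Units.mk0 y hy0, hy'⟩

theorem exists_mon_singleton_sq [Finite K] (ι : K →+* F) (hK : Nat.card K = 2 ^ e) (a : Fin e) :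
    ∃ a' : Fin e, ∀ x : K, mon ι {a} x ^ 2 = mon ι {a'} x := by
  have := Fintype.ofFinite K
  by_cases h : (a : ℕ) + 1 < e
  · refine ⟨⟨a + 1, h⟩, fun x => ?_⟩
    rw [mon_singleton, mon_singleton, ← pow_mul, ← pow_succ]
  · refine ⟨⟨0, by omega⟩, fun x => ?_⟩
    have he : (a : ℕ) + 1 = e := by omega
    rw [mon_singleton, mon_singleton, ← pow_mul, ← pow_succ, he, ← map_pow, ← hK,
      Nat.card_eq_fintype_card, FiniteField.pow_card]
    simp

theorem exists_mon_mul_singleton [Finite K] (ι : K →+* F) (hK : Nat.card K = 2 ^ e)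
    (a c : Fin e) : ∃ P : Finset (Fin e), P.Nonempty ∧ P.card = (if a = c then 1 else 2) ∧
      (a ≠ c → P = {a, c}) ∧ ∀ x : K, mon ι {a} x * mon ι {c} x = mon ι P x := by
  by_cases hac : a = c
  · subst hac
    obtain ⟨a', ha'⟩ := exists_mon_singleton_sq ι hK a
    exact ⟨{a'}, Finset.singleton_nonempty _, by simp, by simp, fun x => by rw [← sq, ha']⟩
  · exact ⟨{a, c}, Finset.insert_nonempty _ _, by rw [if_neg hac, Finset.card_pair hac],
      fun _ => rfl, fun x => (mon_insert ι (by simpa using hac) x).symm⟩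

theorem pair_eq_of_mon_eq [Finite K] [CharP F 2] (ι : K →+* F) (hK : Nat.card K = 2 ^ e)
    {a c a' c' : Fin e}
    (h : ∀ x : Kˣ, mon ι {a} (x : K) * mon ι {c} (x : K) =
      mon ι {a'} (x : K) * mon ι {c'} (x : K)) :
    (a = a' ∧ c = c') ∨ (a = c' ∧ c = a') := by
  obtain ⟨P, hP, hcard, heq, hmon⟩ := exists_mon_mul_singleton ι hK a c
  obtain ⟨Q, hQ, hcard', heq', hmon'⟩ := exists_mon_mul_singleton ι hK a' c'
  have hPQ : P = Q := eq_of_mon_eq ι hK hP hQ fun x => by rw [← hmon, ← hmon', h]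
  rw [hPQ, hcard'] at hcard
  by_cases hac : a = c
  · by_cases hac' : a' = c'
    · subst hac hac'
      have : ({a} : Finset (Fin e)) = {a'} := eq_of_mon_eq ι hK (Finset.singleton_nonempty _)
        (Finset.singleton_nonempty _) fun x => mon_eq_of_sq_eq ι (by rw [sq, sq, h])
      rw [Finset.singleton_inj] at this
      exact Or.inl ⟨this, this⟩
    · rw [if_pos hac, if_neg hac'] at hcard
      omega
  · by_cases hac' : a' = c'
    · rw [if_neg hac, if_pos hac'] at hcard
      omega
    · have := (heq hac).symm.trans (hPQ.trans (heq' hac'))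
      have h₁ : a ∈ ({a', c'} : Finset (Fin e)) := this ▸ Finset.mem_insert_self a _
      have h₂ : c ∈ ({a', c'} : Finset (Fin e)) := this ▸ by simp
      simp only [Finset.mem_insert, Finset.mem_singleton] at h₁ h₂
      grind

namespace IsMonomialModel

variable {M : Type} [AddCommGroup M] [Module F M]
  {ρ : Representation F (Matrix.SpecialLinearGroup (Fin 2) K) M} {ι : K →+* F} [Finite K]
  {hK : Nat.card K = 2 ^ e} {I : Finset (Fin e)} {π : M →ₗ[F] (K → F)}
  {f f' : Matrix.SpecialLinearGroup (Fin 2) K → Matrix.SpecialLinearGroup (Fin 2) K → M}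
  [CharP F 2] [CharP K 2]

theorem pair_eq_of_obstruction_ne_zero (hπ : IsMonomialModel ρ ι hK I π)
    (hf : ρ.IsTwoCocycle f) (hf' : ρ.IsTwoCocycle f') {a c a' c' : Fin e} (ha : a ∉ I) (hc : c ∉ I)
    (ha' : a' ∉ I) (hc' : c' ∉ I) (h : obstruction π ι hK a c f ≠ 0)
    (h' : obstruction π ι hK a' c' f' ≠ 0) : (a = a' ∧ c = c') ∨ (a = c' ∧ c = a') := by
  refine pair_eq_of_mon_eq ι hK fun x => ?_
  obtain ⟨y, hy⟩ := exists_sq_eq x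
  rw [← hy, hπ.weight_of_obstruction_ne_zero hf ha hc h,
    hπ.weight_of_obstruction_ne_zero hf' ha' hc' h']

omit [CharP K 2] in
theorem isTwoCoboundaryOn_top (hπ : IsMonomialModel ρ ι hK I π) (he : 0 < e)
    (hf : ρ.IsTwoCocycle f) (h : ∀ a ∉ I, ∀ c ∉ I, obstruction π ι hK a c f = 0) :
    ρ.IsTwoCoboundaryOn ⊤ f := by
  refine hf.isTwoCoboundaryOn_top (upperHom K).range ?_
    (hπ.isTwoCoboundaryOn_of_obstruction_eq_zero hf h)
  rw [index_range_upperHom, hK, Ne, CharP.cast_eq_zero_iff F 2]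
  have h₁ : 2 ∣ (2 ^ e) ^ 2 := dvd_pow (dvd_pow_self 2 he.ne') two_ne_zero
  have h₂ : 0 < (2 ^ e) ^ 2 := by positivity
  omega

theorem finrank_H2_le_one (hπ : IsMonomialModel ρ ι hK I π) (he : 0 < e) :
    Module.finrank F (groupCohomology (Rep.of ρ) 2) ≤ 1 := by
  refine Representation.finrank_H2_le_one_of_dependent ρ fun f₁ f₂ hf₁ hf₂ => ?_
  by_cases h₁ : ∀ a ∉ I, ∀ c ∉ I, obstruction π ι hK a c f₁ = 0
  · refine ⟨1, 0, Or.inl one_ne_zero, ?_⟩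
    rw [one_smul, zero_smul, add_zero]
    exact hπ.isTwoCoboundaryOn_top he hf₁ h₁
  push Not at h₁
  obtain ⟨a, ha, c, hc, h⟩ := h₁
  refine ⟨-obstruction π ι hK a c f₂, obstruction π ι hK a c f₁, Or.inr h, ?_⟩
  have hg := (hf₁.smul (-obstruction π ι hK a c f₂)).add (hf₂.smul (obstruction π ι hK a c f₁))
  refine hπ.isTwoCoboundaryOn_top he hg fun a' ha' c' hc' => ?_
  have hzero : obstruction π ι hK a c (-obstruction π ι hK a c f₂ • f₁ +
      obstruction π ι hK a c f₁ • f₂) = 0 := by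
    simp only [map_add, map_smul, smul_eq_mul]
    ring
  by_contra hne
  rcases hπ.pair_eq_of_obstruction_ne_zero hf₁ hg ha hc ha' hc' h hne with
    ⟨rfl, rfl⟩ | ⟨rfl, rfl⟩
  · exact hne hzero
  · by_cases hac : a = c
    · subst hac
      exact hne hzero
    · rw [obstruction_symm ι hK hac, hzero, neg_zero] at hne
      exact hne rfl

theorem finrank_H2_eq_zero (hπ : IsMonomialModel ρ ι hK ∅ π) (he : 3 ≤ e) :
    Module.finrank F (groupCohomology (Rep.of ρ) 2) = 0 := by
  refine Representation.finrank_H2_eq_zero_of_coboundary ρ fun f hf => ?_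
  refine hπ.isTwoCoboundaryOn_top (by omega) hf fun a ha c hc => ?_
  by_contra h
  obtain ⟨P, hP, hcard, -, hmon⟩ := exists_mon_mul_singleton ι hK a c
  have huniv : P = Finset.univ := by
    refine eq_of_mon_eq ι hK hP ⟨⟨0, by omega⟩, Finset.mem_univ _⟩ fun x => ?_
    obtain ⟨y, hy⟩ := exists_sq_eq x
    rw [← hmon, mon_univ ι hK, ← hy, hπ.weight_of_obstruction_ne_zero hf ha hc h, mon_empty]
  rw [huniv, Finset.card_univ, Fintype.card_fin] at hcard
  split_ifs at hcard <;> omega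

end IsMonomialModel

end FrobeniusMonomial

namespace Matrix.SpecialLinearGroup

variable {K F M : Type} [Field K] [Field F] [AddCommGroup M] [Module F M]
variable (ρ : Representation F (SpecialLinearGroup (Fin 2) K) M)

/-- `m` is fixed by the upper unitriangular matrices and the torus acts on it through `χ`. -/
structure IsBorelEigenvector (χ : Kˣ →* F) (m : M) : Prop where
  ne_zero : m ≠ 0
  map_upper : ∀ b, ρ (upper b) m = m
  map_torus : ∀ a, ρ (torus a) m = χ a • m

variable {ρ}

theorem upper_upper (b b' : K) (m : M) :
    ρ (upper b) (ρ (upper b') m) = ρ (upper (b + b')) m := by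
  rw [← upper_mul, map_mul, Module.End.mul_apply]

theorem torus_upper (a : Kˣ) (b : K) (m : M) :
    ρ (torus a) (ρ (upper b) m) = ρ (upper ((a : K) ^ 2 * b)) (ρ (torus a) m) := by
  rw [← Module.End.mul_apply, ← map_mul, torus_mul_upper, map_mul, Module.End.mul_apply]

variable [CharP K 2]

theorem weyl_weyl (m : M) : ρ (weyl K) (ρ (weyl K) m) = m := by
  rw [← Module.End.mul_apply, ← map_mul, weyl_mul_weyl, map_one, Module.End.one_apply]

theorem weyl_torus (a : Kˣ) (m : M) :
    ρ (weyl K) (ρ (torus a) m) = ρ (torus a⁻¹) (ρ (weyl K) m) := by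
  rw [← Module.End.mul_apply, ← map_mul, weyl_mul_torus, map_mul, Module.End.mul_apply]

theorem exists_borel_eigenvector [Finite K] [CharP F 2] [IsAlgClosed F] [FiniteDimensional F M]
    {W : Submodule F M} (hW : W ≠ ⊥) (hWu : ∀ b, ∀ m ∈ W, ρ (upper b) m ∈ W)
    (hWt : ∀ a, ∀ m ∈ W, ρ (torus a) m ∈ W) :
    ∃ χ : Kˣ →* F, ∃ m ∈ W, IsBorelEigenvector ρ χ m := by
  classical
  have := Fintype.ofFinite K
  have key : ∀ S : Finset K, ∃ v ∈ W, v ≠ 0 ∧ ∀ b ∈ S, ρ (upper b) v = v := by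
    intro S
    induction S using Finset.induction_on with
    | empty =>
      obtain ⟨v, hv, hv0⟩ := W.ne_bot_iff.1 hW
      exact ⟨v, hv, hv0, by simp⟩
    | insert b S hbS ih =>
      obtain ⟨v, hvW, hv, hS⟩ := ih
      by_cases h : ρ (upper b) v = v
      · refine ⟨v, hvW, hv, fun b' hb' => ?_⟩
        rcases Finset.mem_insert.1 hb' with rfl | h'
        · exact h
        · exact hS b' h'
      · refine ⟨ρ (upper b) v - v, W.sub_mem (hWu b v hvW) hvW, sub_ne_zero.2 h,
          fun b' hb' => ?_⟩
        rw [map_sub, upper_upper]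
        rcases Finset.mem_insert.1 hb' with rfl | h'
        · have h2 : (2 : F) • (v - ρ (upper b') v) = 0 := by
            rw [CharTwo.two_eq_zero, zero_smul]
          rw [CharTwo.add_self_eq_zero, upper_zero, map_one, Module.End.one_apply]
          linear_combination (norm := module) h2
        · rw [add_comm, ← upper_upper, hS b' h']
  let W' : Submodule F M :=
    { carrier := {v | v ∈ W ∧ ∀ b, ρ (upper b) v = v}
      add_mem' := fun hx hy => ⟨W.add_mem hx.1 hy.1, fun b => by rw [map_add, hx.2, hy.2]⟩
      zero_mem' := ⟨W.zero_mem, fun b => map_zero _⟩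
      smul_mem' := fun c x hx => ⟨W.smul_mem c hx.1, fun b => by rw [map_smul, hx.2]⟩ }
  obtain ⟨v₀, hv₀W, hv₀, hv₀u⟩ := key Finset.univ
  have : Nontrivial W' := ⟨⟨⟨v₀, hv₀W, fun b => hv₀u b (Finset.mem_univ b)⟩, 0,
    fun h => hv₀ (congrArg Subtype.val h)⟩⟩
  have hT : ∀ a, ∀ v ∈ W', ρ (torus a) v ∈ W' := fun a v hv => ⟨hWt a v hv.1, fun b => by
    have : b = (a : K) ^ 2 * (((a⁻¹ : Kˣ) : K) ^ 2 * b) := by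
      rw [← mul_assoc, ← mul_pow, Units.mul_inv, one_pow, one_mul]
    rw [this, ← torus_upper, hv.2]⟩
  obtain ⟨g, hg⟩ := IsCyclic.exists_generator (α := Kˣ)
  obtain ⟨μ, hμ⟩ := Module.End.exists_eigenvalue ((ρ (torus g)).restrict (hT g))
  obtain ⟨v, hv, hv0⟩ := hμ.exists_hasEigenvector
  have hv1 : ρ (torus g) (v : M) = μ • (v : M) := congrArg Subtype.val
    (Module.End.mem_eigenspace_iff.1 hv)
  have hv0' : (v : M) ≠ 0 := fun h => hv0 (Subtype.ext h)
  have hc : ∀ a, ∃ c : F, ρ (torus a) (v : M) = c • (v : M) := by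
    intro a
    obtain ⟨n, rfl⟩ := (Submonoid.mem_powers_iff _ _).1 (mem_powers_iff_mem_zpowers.2 (hg a))
    refine ⟨μ ^ n, ?_⟩
    have : torus (g ^ n) = torus g ^ n := map_pow (torusHom K) g n
    rw [this, map_pow]
    induction n with
    | zero => simp
    | succ n ih =>
      rw [pow_succ, Module.End.mul_apply, hv1, map_smul, ih (map_pow (torusHom K) g n), smul_smul,
        pow_succ, mul_comm]
  choose χ hχ using hc
  refine ⟨⟨⟨χ, ?_⟩, ?_⟩, v, v.2.1, hv0', v.2.2, hχ⟩
  · refine smul_left_injective F hv0' ?_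
    simp only [← hχ, one_smul]
    rw [show torus (1 : Kˣ) = 1 from (torusHom K).map_one, map_one, Module.End.one_apply]
  · intro a a'
    refine smul_left_injective F hv0' ?_
    simp only [← hχ]
    rw [← torus_mul, map_mul, Module.End.mul_apply, hχ, map_smul, hχ, smul_smul, mul_comm]

namespace IsBorelEigenvector

variable {χ : Kˣ →* F} {m : M}

theorem eq_top (hm : IsBorelEigenvector ρ χ m)
    (hirred : ∀ P : Submodule F M, (∀ g x, x ∈ P → ρ g x ∈ P) → P = ⊥ ∨ P = ⊤)
    {N : Submodule F M} (hmN : m ∈ N) (hN : ∀ b, ρ (upper b) (ρ (weyl K) m) ∈ N) : N = ⊤ := by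
  have hspan : Submodule.span F (Set.range fun g => ρ g m) = ⊤ := by
    refine (hirred _ fun g x hx => ?_).resolve_left fun h => hm.ne_zero ?_
    · induction hx using Submodule.span_induction with
      | mem x hx =>
        obtain ⟨h, rfl⟩ := hx
        exact Submodule.subset_span ⟨g * h, by simp only [map_mul, Module.End.mul_apply]⟩
      | zero => rw [map_zero]; exact Submodule.zero_mem _
      | add x y _ _ hx hy => rw [map_add]; exact Submodule.add_mem _ hx hy
      | smul c x _ hx => rw [map_smul]; exact Submodule.smul_mem _ _ hx
    · refine (Submodule.mem_bot F).1 (h ▸ Submodule.subset_span ⟨1, ?_⟩)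
      simp
  rw [eq_top_iff, ← hspan, Submodule.span_le]
  rintro _ ⟨g, rfl⟩
  by_cases hg : g 1 0 = 0
  · obtain ⟨a, b, rfl⟩ := exists_eq_torus_mul_upper g hg
    simp only [map_mul, Module.End.mul_apply, hm.map_upper, hm.map_torus]
    exact N.smul_mem _ hmN
  · obtain ⟨a, b, b', rfl⟩ := exists_eq_bruhat g hg
    have h := weyl_torus (ρ := ρ) a⁻¹ m
    rw [inv_inv, hm.map_torus] at h
    simp only [map_mul, Module.End.mul_apply, hm.map_upper, ← h, map_smul]
    exact N.smul_mem _ (hN b)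

theorem weyl_upper_weyl (hm : IsBorelEigenvector ρ χ m) (a : Kˣ) :
    ρ (weyl K) (ρ (upper (a : K)) (ρ (weyl K) m)) =
      χ a • ρ (upper ((a⁻¹ : Kˣ) : K)) (ρ (weyl K) m) := by
  have h := congrArg (fun g => ρ (upper ((a⁻¹ : Kˣ) : K)) (ρ g m)) (weyl_mul_torus_eq a)
  simp only [map_mul, Module.End.mul_apply, hm.map_upper, hm.map_torus, map_smul, upper_upper,
    Units.val_inv_eq_inv_val, CharTwo.add_self_eq_zero, upper_zero, map_one,
    Module.End.one_apply] at h
  rw [← h, Units.val_inv_eq_inv_val]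

theorem torus_weyl (hm : IsBorelEigenvector ρ χ m) (a : Kˣ) :
    ρ (torus a) (ρ (weyl K) m) = χ a⁻¹ • ρ (weyl K) m := by
  have h := weyl_torus (ρ := ρ) a⁻¹ m
  rwa [inv_inv, hm.map_torus, map_smul, eq_comm] at h

variable [Fintype K] [DecidableEq K]

omit [CharP K 2] in
theorem _root_.FiniteField.sum_eq_add_sum_units {V : Type} [AddCommMonoid V] (f : K → V) :
    ∑ b, f b = f 0 + ∑ a : Kˣ, f a := by
  rw [Fintype.sum_eq_add_sum_subtype_ne f 0]
  congr 1
  exact (unitsEquivNeZero.sum_comp (fun b : {b : K // b ≠ 0} => f b)).symm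

theorem weyl_sum (hm : IsBorelEigenvector ρ χ m) :
    ρ (weyl K) (∑ b, ρ (upper b) (ρ (weyl K) m)) =
      m + ∑ a : Kˣ, χ a • ρ (upper ((a⁻¹ : Kˣ) : K)) (ρ (weyl K) m) := by
  rw [map_sum, FiniteField.sum_eq_add_sum_units, upper_zero, map_one, Module.End.one_apply,
    weyl_weyl]
  simp only [hm.weyl_upper_weyl]

omit [CharP K 2] [DecidableEq K] in
theorem sum_upper_upper (b : K) (x : M) :
    ∑ b', ρ (upper b') (ρ (upper b) x) = ∑ b', ρ (upper b') x := by
  simp only [upper_upper]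
  exact Equiv.sum_comp (Equiv.addRight b) fun b' => ρ (upper b') x

omit [CharP K 2] [DecidableEq K] in
theorem upper_sum (b : K) (x : M) :
    ρ (upper b) (∑ b', ρ (upper b') x) = ∑ b', ρ (upper b') x := by
  simp only [map_sum, upper_upper]
  exact Equiv.sum_comp (Equiv.addLeft b) fun b' => ρ (upper b') x

omit [CharP K 2] [DecidableEq K] in
theorem torus_sum (a : Kˣ) (x : M) :
    ρ (torus a) (∑ b', ρ (upper b') x) = ∑ b', ρ (upper b') (ρ (torus a) x) := by
  simp only [map_sum, torus_upper]
  exact Equiv.sum_comp (Equiv.mulLeft₀ ((a : K) ^ 2) (pow_ne_zero 2 a.ne_zero))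
    fun b' => ρ (upper b') (ρ (torus a) x)

/-- For a nontrivial irreducible module, the sum of the translates of the lowest weight vector
either vanishes or is the highest weight vector. -/
theorem sum_eq_zero_or_eq [CharP F 2] (hm : IsBorelEigenvector ρ χ m)
    (hirred : ∀ P : Submodule F M, (∀ g x, x ∈ P → ρ g x ∈ P) → P = ⊥ ∨ P = ⊤)
    (hne : ∃ g x, ρ g x ≠ x) :
    ∑ b, ρ (upper b) (ρ (weyl K) m) = 0 ∨ ∑ b, ρ (upper b) (ρ (weyl K) m) = m := by
  set v := ρ (weyl K) m with hv
  set s := ∑ b, ρ (upper b) v with hs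
  have hcard : ((Fintype.card K : ℕ) : F) = 0 := by
    rw [CharP.cast_eq_zero_iff F 2, ← CharP.cast_eq_zero_iff K 2]
    exact FiniteField.cast_card_eq_zero K
  by_cases hχ : χ = 1
  · right
    have hw : ρ (weyl K) (s + m) = s + m := by
      have h1 := hm.weyl_sum
      have h2 := FiniteField.sum_eq_add_sum_units fun b => ρ (upper b) v
      have h3 : ∑ a : Kˣ, ρ (upper ((a⁻¹ : Kˣ) : K)) v = ∑ a : Kˣ, ρ (upper (a : K)) v :=
        Equiv.sum_comp (Equiv.inv Kˣ) fun a => ρ (upper (a : K)) v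
      simp only [hχ, MonoidHom.one_apply, one_smul, ← hv, h3] at h1
      rw [upper_zero, map_one, Module.End.one_apply] at h2
      rw [map_add, hs, h1, h2]
      abel
    have hu : ∀ b, ρ (upper b) (s + m) = s + m := fun b => by
      rw [map_add, hm.map_upper, hs, upper_sum]
    let H : Subgroup (SpecialLinearGroup (Fin 2) K) :=
      { carrier := {g | ρ g (s + m) = s + m}
        mul_mem' := fun {g h} hg hh => by
          change ρ (g * h) (s + m) = s + m
          rw [map_mul, Module.End.mul_apply, hh, hg]
        one_mem' := by
          change ρ 1 (s + m) = s + m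
          rw [map_one, Module.End.one_apply]
        inv_mem' := fun {g} hg => by
          change ρ g⁻¹ (s + m) = s + m
          conv_lhs => rw [← show ρ g (s + m) = s + m from hg]
          rw [← Module.End.mul_apply, ← map_mul, inv_mul_cancel, map_one, Module.End.one_apply] }
    have hH : H = ⊤ := closure_eq_top hu hw
    have hG : ∀ g, ρ g (s + m) = s + m := fun g => (hH ▸ Subgroup.mem_top g : g ∈ H)
    rcases hirred (Submodule.span F {s + m}) fun g x hx => by
      obtain ⟨c, rfl⟩ := Submodule.mem_span_singleton.1 hx
      rw [map_smul, hG]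
      exact hx with h | h
    · have h0 := Submodule.span_singleton_eq_bot.1 h
      have h2 : (2 : F) • m = 0 := by rw [CharTwo.two_eq_zero, zero_smul]
      linear_combination (norm := module) h0 - h2
    · obtain ⟨g, x, hx⟩ := hne
      obtain ⟨c, rfl⟩ := Submodule.mem_span_singleton.1 (h ▸ Submodule.mem_top : x ∈ _)
      exact absurd (by rw [map_smul, hG]) hx
  · left
    by_contra hs0
    have hsum : ∑ a : Kˣ, χ a = 0 := by
      rw [sum_hom_units_eq_zero χ hχ]
    have hsm : IsBorelEigenvector ρ (χ.comp invMonoidHom) s := by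
      refine ⟨hs0, fun b => upper_sum b v, fun a => ?_⟩
      rw [hs, torus_sum, hv, hm.torus_weyl]
      simp only [map_smul, ← Finset.smul_sum]
      rfl
    let N : M →ₗ[F] M := ∑ b, ρ (upper b)
    have hN : ∀ x, N x = ∑ b, ρ (upper b) x := fun x => LinearMap.sum_apply _ _ _
    have hfix : ∀ x, (∀ b, ρ (upper b) x = x) → N x = 0 := by
      intro x hx
      rw [hN, Finset.sum_congr rfl fun b _ => hx b, Finset.sum_const, Finset.card_univ,
        ← Nat.cast_smul_eq_nsmul F, hcard, zero_smul]
    have htop : LinearMap.ker N = ⊤ := by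
      refine hsm.eq_top hirred (hfix s fun b => upper_sum b v) fun b => ?_
      rw [LinearMap.mem_ker, hN, sum_upper_upper, hs, hm.weyl_sum, ← hN, map_add,
        hfix m hm.map_upper, zero_add, map_sum]
      have hNu : ∀ b x, N (ρ (upper b) x) = N x := fun b x => by
        rw [hN, hN, sum_upper_upper]
      simp only [map_smul, hNu]
      rw [← Finset.sum_smul, hsum, zero_smul]
    refine hs0 ?_
    rw [hs, ← hN]
    exact LinearMap.mem_ker.1 (htop ▸ Submodule.mem_top)

end IsBorelEigenvector

end Matrix.SpecialLinearGroup

namespace Matrix.SpecialLinearGroup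

open FrobeniusMonomial

section OrbitMap

variable {K F M : Type} [Field K] [CharP K 2] [Field F] [AddCommGroup M] [Module F M]
variable {ρ : Representation F (SpecialLinearGroup (Fin 2) K) M}

theorem exists_borel_functional [Finite K] [CharP F 2] [IsAlgClosed F] [FiniteDimensional F M]
    [Nontrivial M] (ρ : Representation F (SpecialLinearGroup (Fin 2) K) M) :
    ∃ (l : M →ₗ[F] F) (χ : Kˣ →* F), l ≠ 0 ∧ (∀ b m, l (ρ (upper b) m) = l m) ∧
      ∀ a m, l (ρ (torus a⁻¹) m) = χ a * l m := by
  obtain ⟨χ, l, -, hl⟩ := exists_borel_eigenvector (ρ := ρ.dual) (W := ⊤) top_ne_bot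
    (fun _ _ _ => Submodule.mem_top) fun _ _ _ => Submodule.mem_top
  refine ⟨l, χ, hl.ne_zero, fun b m => ?_, fun a m => ?_⟩
  · have h := LinearMap.congr_fun (hl.map_upper b) (ρ (upper b) m)
    rw [Representation.dual_apply, Module.Dual.transpose_apply, LinearMap.comp_apply] at h
    rw [← h, ← Module.End.mul_apply, ← map_mul, inv_mul_cancel, map_one, Module.End.one_apply]
  · have h := LinearMap.congr_fun (hl.map_torus a) m
    rw [Representation.dual_apply, Module.Dual.transpose_apply, LinearMap.comp_apply] at h
    rw [← show (torus a)⁻¹ = torus a⁻¹ from ((torusHom K).map_inv a).symm, h]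
    rfl

variable (ρ) in
/-- The map sending `m` to the function `x ↦ l (w u(x) m)`. -/
def orbitMap (l : M →ₗ[F] F) : M →ₗ[F] (K → F) :=
  LinearMap.pi fun x => l ∘ₗ ρ (weyl K * upper x)

theorem orbitMap_apply (l : M →ₗ[F] F) (m : M) (x : K) :
    orbitMap ρ l m x = l (ρ (weyl K) (ρ (upper x) m)) := by
  rw [orbitMap, LinearMap.pi_apply, LinearMap.comp_apply, map_mul, Module.End.mul_apply]

theorem orbitMap_upper (l : M →ₗ[F] F) (b : K) (m : M) :
    orbitMap ρ l (ρ (upper b) m) = translate F b (orbitMap ρ l m) := by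
  funext x
  rw [FrobeniusMonomial.translate_apply, orbitMap_apply, orbitMap_apply, upper_upper]

theorem orbitMap_torus {l : M →ₗ[F] F} {χ : Kˣ →* F}
    (hl : ∀ a m, l (ρ (torus a⁻¹) m) = χ a * l m) (a : Kˣ) (m : M) :
    orbitMap ρ l (ρ (torus a) m) =
      χ a • dilate F (((a⁻¹ : Kˣ) : K) ^ 2) (orbitMap ρ l m) := by
  funext x
  have hx : x = (a : K) ^ 2 * (((a⁻¹ : Kˣ) : K) ^ 2 * x) := by
    rw [← mul_assoc, ← mul_pow, Units.mul_inv, one_pow, one_mul]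
  rw [Pi.smul_apply, dilate_apply, orbitMap_apply, orbitMap_apply]
  conv_lhs => rw [hx]
  rw [← torus_upper, weyl_torus, hl, smul_eq_mul]

theorem orbitMap_injective [Finite K] [CharP F 2] [IsAlgClosed F] [FiniteDimensional F M]
    (hirred : ∀ P : Submodule F M, (∀ g x, x ∈ P → ρ g x ∈ P) → P = ⊥ ∨ P = ⊤)
    {l : M →ₗ[F] F} {χ : Kˣ →* F} (hl₀ : l ≠ 0) (hlu : ∀ b m, l (ρ (upper b) m) = l m)
    (hlt : ∀ a m, l (ρ (torus a⁻¹) m) = χ a * l m) :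
    Function.Injective (orbitMap ρ l) := by
  classical
  have := Fintype.ofFinite K
  have hker : LinearMap.ker l ≠ ⊤ := fun h => hl₀ (LinearMap.ker_eq_top.1 h)
  by_cases hne : ∃ g x, ρ g x ≠ x
  · rw [← LinearMap.ker_eq_bot]
    by_contra hbot
    obtain ⟨η, m, hmker, hm⟩ := exists_borel_eigenvector (ρ := ρ) hbot
      (fun b m hm => by rw [LinearMap.mem_ker] at hm ⊢; rw [orbitMap_upper, hm, map_zero])
      fun a m hm => by
        rw [LinearMap.mem_ker] at hm ⊢
        rw [orbitMap_torus hlt, hm, map_zero, smul_zero]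
    have hlv : l (ρ (weyl K) m) = 0 := by
      have := congrFun (LinearMap.mem_ker.1 hmker) 0
      rwa [orbitMap_apply, hm.map_upper] at this
    have hlm : l m ≠ 0 := fun h => hker (hm.eq_top hirred h fun b => by
      rw [LinearMap.mem_ker, hlu, hlv])
    have hls : l (∑ b, ρ (upper b) (ρ (weyl K) m)) = 0 := by
      simp only [map_sum, hlu, hlv, Finset.sum_const_zero]
    have hlws : l (ρ (weyl K) (∑ b, ρ (upper b) (ρ (weyl K) m))) = l m := by
      simp only [hm.weyl_sum, map_add, map_sum, map_smul, hlu, hlv, smul_zero,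
        Finset.sum_const_zero, add_zero]
    rcases hm.sum_eq_zero_or_eq hirred hne with h | h
    · rw [h, map_zero, map_zero] at hlws
      exact hlm hlws.symm
    · rw [h] at hls
      exact hlm hls
  · push Not at hne
    have hbot : LinearMap.ker l = ⊥ := (hirred _ fun g x hx => by rwa [hne]).resolve_right hker
    rw [← LinearMap.ker_eq_bot, eq_bot_iff, ← hbot]
    intro m hm
    have := congrFun (LinearMap.mem_ker.1 hm) 0
    rwa [orbitMap_apply, hne, hne] at this

end OrbitMap

end Matrix.SpecialLinearGroup

namespace FrobeniusMonomial

open Matrix.SpecialLinearGroup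

section Coordinates

variable {K F : Type} [Field K] [Field F] {e : ℕ} (ι : K →+* F)

theorem mon_empty_eq : mon ι (∅ : Finset (Fin e)) = fun _ : K => (1 : F) := funext (mon_empty ι)

variable [Finite K] (hK : Nat.card K = 2 ^ e)

theorem repr_dilate (a : K) (φ : K → F) (C : Finset (Fin e)) :
    (basis ι hK).repr (dilate F a φ) C = mon ι C a * (basis ι hK).repr φ C := by
  have : (basis ι hK).coord C ∘ₗ dilate F a = mon ι C a • (basis ι hK).coord C :=
    ext_mon ι hK fun D => by
      simp only [LinearMap.comp_apply, LinearMap.smul_apply, dilate_mon, map_smul]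
      rw [← basis_apply ι hK D, Module.Basis.coord_apply, Module.Basis.repr_self]
      by_cases h : D = C
      · rw [h, basis_apply]
      · rw [Finsupp.single_eq_of_ne (Ne.symm h), smul_zero, smul_zero]
  exact LinearMap.congr_fun this φ

theorem repr_lower {a : Fin e} {C : Finset (Fin e)} (ha : a ∈ C) (φ : K → F) :
    (basis ι hK).repr (lower ι hK a φ) (C.erase a) = (basis ι hK).repr φ C := by
  have : (basis ι hK).coord (C.erase a) ∘ₗ lower ι hK a = (basis ι hK).coord C :=
    ext_mon ι hK fun D => by
      rw [LinearMap.comp_apply, lower_mon]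
      split_ifs with h
      · rw [← basis_apply ι hK, ← basis_apply ι hK, Module.Basis.coord_apply,
          Module.Basis.repr_self, Module.Basis.coord_apply, Module.Basis.repr_self,
          Finsupp.single_apply, Finsupp.single_apply]
        congr 1
        rw [eq_iff_iff]
        exact ⟨fun h' => by rw [← Finset.insert_erase h, h', Finset.insert_erase ha],
          fun h' => by rw [h']⟩
      · rw [map_zero, ← basis_apply ι hK, Module.Basis.coord_apply, Module.Basis.repr_self,
          Finsupp.single_eq_of_ne]
        rintro rfl
        exact h ha
  exact LinearMap.congr_fun this φ

theorem sum_repr_smul_mon (φ : K → F) : ∑ C, (basis ι hK).repr φ C • mon ι C = φ := by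
  simp only [← basis_apply ι hK, Module.Basis.sum_repr]

/-- A translation invariant subspace containing `φ` contains the monomials of all subsets of `I`,
if `I` and possibly `∅` are the only sets contributing to `φ`. -/
theorem mon_mem_of_repr [CharP F 2] {P : Submodule F (K → F)}
    (hP : ∀ b, ∀ φ ∈ P, translate F b φ ∈ P) (h₁ : (fun _ => 1) ∈ P) {φ : K → F} (hφ : φ ∈ P)
    {I : Finset (Fin e)} (hI : (basis ι hK).repr φ I ≠ 0)
    (h : ∀ C, (basis ι hK).repr φ C ≠ 0 → C = I ∨ C = ∅) {C : Finset (Fin e)} (hC : C ⊆ I) :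
    mon ι C ∈ P := by
  rw [← mon_empty_eq ι (e := e)] at h₁
  have hmonI : mon ι I ∈ P := by
    by_cases hI0 : I = ∅
    · rwa [hI0]
    have hsum := sum_repr_smul_mon ι hK φ
    rw [Finset.sum_eq_add I ∅ hI0 (fun C _ hC => by
      by_cases h0 : (basis ι hK).repr φ C = 0
      · rw [h0, zero_smul]
      · rcases h C h0 with h | h
        · exact absurd h hC.1
        · exact absurd h hC.2) (by simp) (by simp)] at hsum
    have hmem : (basis ι hK).repr φ I • mon ι I ∈ P := by
      rw [← hsum] at hφ
      exact (P.add_mem_iff_left (P.smul_mem _ h₁)).1 hφ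
    exact (P.smul_mem_iff hI).1 hmem
  have := divide_mem ι hK hP (I \ C) hmonI
  rwa [divide_mon, if_pos Finset.sdiff_subset, Finset.sdiff_sdiff_eq_self hC] at this

theorem mem_of_lower_eq_zero {P : Submodule F (K → F)} {I : Finset (Fin e)}
    (hP : ∀ C ⊆ I, mon ι C ∈ P) {φ : K → F} (hφ : ∀ a ∉ I, lower ι hK a φ = 0) : φ ∈ P := by
  rw [← sum_repr_smul_mon ι hK φ]
  refine P.sum_mem fun C _ => ?_
  by_cases hC : C ⊆ I
  · exact P.smul_mem _ (hP C hC)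
  · obtain ⟨a, haC, haI⟩ := Finset.not_subset.1 hC
    rw [← repr_lower ι hK haC, hφ a haI, map_zero, Finsupp.zero_apply, zero_smul]
    exact P.zero_mem

theorem lower_eq_zero_of_repr {φ : K → F} {a : Fin e}
    (h : ∀ C, (basis ι hK).repr φ C ≠ 0 → a ∉ C) : lower ι hK a φ = 0 := by
  rw [← sum_repr_smul_mon ι hK φ, map_sum]
  refine Finset.sum_eq_zero fun C _ => ?_
  by_cases h0 : (basis ι hK).repr φ C = 0
  · rw [h0, zero_smul, map_zero]
  · rw [map_smul, lower_mon, if_neg (h C h0), smul_zero]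

end Coordinates

variable {K F M : Type} [Field K] [CharP K 2] [Field F] [CharP F 2] [IsAlgClosed F]
  [AddCommGroup M] [Module F M] [FiniteDimensional F M] [Nontrivial M] [Finite K] {e : ℕ}
  {ρ : Representation F (Matrix.SpecialLinearGroup (Fin 2) K) M}

theorem exists_isMonomialModel (ι : K →+* F) (hK : Nat.card K = 2 ^ e)
    (hirred : ∀ P : Submodule F M, (∀ g x, x ∈ P → ρ g x ∈ P) → P = ⊥ ∨ P = ⊤) :
    ∃ (I : Finset (Fin e)) (π : M →ₗ[F] (K → F)), IsMonomialModel ρ ι hK I π := by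
  obtain ⟨l, χ, hl₀, hlu, hlt⟩ := exists_borel_functional ρ
  have hinj := orbitMap_injective hirred hl₀ hlu hlt
  set π := orbitMap ρ l with hπ
  obtain ⟨η, m, -, hm⟩ := exists_borel_eigenvector (ρ := ρ) (W := ⊤) top_ne_bot
    (fun _ _ _ => Submodule.mem_top) fun _ _ _ => Submodule.mem_top
  have hconst : π m = fun _ => π m 0 := funext (eq_const_of_translate fun b => by
    rw [hπ, ← orbitMap_upper, hm.map_upper])
  have hm0 : π m 0 ≠ 0 := by
    intro h
    refine hm.ne_zero (hinj ?_)
    rw [map_zero, hconst, h]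
    rfl
  have hηχ : ∀ a, η a = χ a := by
    intro a
    have := congrFun (orbitMap_torus hlt a m) 0
    rw [hm.map_torus, map_smul, Pi.smul_apply, Pi.smul_apply, dilate_apply, mul_zero] at this
    exact mul_right_cancel₀ hm0 this
  set ψ := π (ρ (weyl K) m) with hψ
  have hψ0 : ψ ≠ 0 := by
    intro h
    have h0 : ρ (weyl K) m = 0 := hinj (by rw [map_zero]; exact h)
    refine hm.ne_zero ?_
    rw [← weyl_weyl (ρ := ρ) m, h0, map_zero]
  have hχmon : ∀ C, (basis ι hK).repr ψ C ≠ 0 → ∀ a : Kˣ, χ a = mon ι C (a : K) := by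
    intro C hC a
    have h1 := orbitMap_torus hlt a (ρ (weyl K) m)
    rw [hm.torus_weyl, map_smul] at h1
    have h2 := congrArg (fun φ => (basis ι hK).repr φ C) h1
    simp only [map_smul, Finsupp.smul_apply, repr_dilate, smul_eq_mul, ← mul_assoc] at h2
    have h3 := mul_right_cancel₀ hC h2
    have h4 : χ a * χ a⁻¹ = 1 := by rw [← map_mul, mul_inv_cancel, map_one]
    have h5 : mon ι C (a : K) * mon ι C ((a⁻¹ : Kˣ) : K) = 1 := by
      rw [← mon_mul, Units.mul_inv]
      simp [mon]
    rw [hηχ, mon_sq] at h3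
    refine frobenius_inj F 2 ?_
    change χ a ^ 2 = mon ι C (a : K) ^ 2
    linear_combination -(χ a * mon ι C (a : K) ^ 2 * h3) + mon ι C (a : K) ^ 2 * h4 -
      χ a ^ 2 * (mon ι C (a : K) * mon ι C ((a⁻¹ : Kˣ) : K) + 1) * h5
  obtain ⟨I, hI, hall⟩ : ∃ I, (basis ι hK).repr ψ I ≠ 0 ∧
      ∀ C, (basis ι hK).repr ψ C ≠ 0 → C = I ∨ C = ∅ := by
    by_cases h : ∃ C, C.Nonempty ∧ (basis ι hK).repr ψ C ≠ 0
    · obtain ⟨I, hI, hI0⟩ := h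
      refine ⟨I, hI0, fun C hC => ?_⟩
      rcases C.eq_empty_or_nonempty with hC' | hC'
      · exact Or.inr hC'
      · exact Or.inl (eq_of_mon_eq ι hK hC' hI fun a => by rw [← hχmon C hC, ← hχmon I hI0])
    · push Not at h
      have h' : ∀ C, (basis ι hK).repr ψ C ≠ 0 → C = ∅ := fun C hC => by
        by_contra hne
        exact hC (h C (Finset.nonempty_iff_ne_empty.2 hne))
      refine ⟨∅, fun h0 => hψ0 ?_, fun C hC => Or.inr (h' C hC)⟩
      rw [← sum_repr_smul_mon ι hK ψ]
      refine Finset.sum_eq_zero fun C _ => ?_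
      by_cases hC : (basis ι hK).repr ψ C = 0
      · rw [hC, zero_smul]
      · rw [h' C hC, h0, zero_smul]
  refine ⟨I, π, hinj, orbitMap_upper l, fun κ x => ?_, fun φ => ⟨?_, fun hφ => ?_⟩⟩
  · rw [hπ, orbitMap_torus hlt, hχmon I hI]
  · rintro ⟨x, rfl⟩ a ha
    have htop : LinearMap.ker (lower ι hK a ∘ₗ π) = ⊤ := by
      refine hm.eq_top hirred ?_ fun b => ?_
      · rw [LinearMap.mem_ker, LinearMap.comp_apply, hconst, lower_const]
      · rw [LinearMap.mem_ker, LinearMap.comp_apply, hπ, orbitMap_upper, lower_translate, ← hπ,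
          ← hψ, lower_eq_zero_of_repr ι hK, map_zero]
        intro C hC
        rcases hall C hC with rfl | rfl
        · exact ha
        · exact Finset.notMem_empty a
    exact LinearMap.mem_ker.1 (htop ▸ Submodule.mem_top : x ∈ LinearMap.ker (lower ι hK a ∘ₗ π))
  · refine mem_of_lower_eq_zero ι hK (P := LinearMap.range π) (fun C hC => ?_) hφ
    refine mon_mem_of_repr ι hK ?_ ?_ (LinearMap.mem_range_self π _) hI hall hC
    · rintro b _ ⟨x, rfl⟩
      exact ⟨ρ (upper b) x, orbitMap_upper l b x⟩
    · refine ⟨(π m 0)⁻¹ • m, ?_⟩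
      rw [map_smul, hconst]
      funext x
      exact inv_mul_cancel₀ hm0

theorem two_le_finrank (hne : ∃ g m, ρ g m ≠ m) : 2 ≤ Module.finrank F M := by
  by_contra hlt
  have h1 : Module.finrank F M = 1 := by
    have := Module.finrank_pos (R := F) (M := M)
    omega
  obtain ⟨η, m, -, hm⟩ := exists_borel_eigenvector (ρ := ρ) (W := ⊤) top_ne_bot
    (fun _ _ _ => Submodule.mem_top) fun _ _ _ => Submodule.mem_top
  obtain ⟨g, x, hx⟩ := hne
  refine hx ?_
  rw [eq_one_of_upper (fun b => LinearMap.ext fun y => ?_) g, Module.End.one_apply]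
  obtain ⟨c, rfl⟩ := (finrank_eq_one_iff_of_nonzero' m hm.ne_zero).1 h1 y
  rw [map_smul, hm.map_upper, Module.End.one_apply]

theorem defining_characteristic_bound (hK : Nat.card K = 2 ^ e) (he : 2 ≤ e)
    (hirred : ∀ P : Submodule F M, (∀ g x, x ∈ P → ρ g x ∈ P) → P = ⊥ ∨ P = ⊤) :
    2 * Module.finrank F (groupCohomology (Rep.of ρ) 2) ≤ Module.finrank F M ∨
      (e = 2 ∧ Module.finrank F M = 1 ∧ ∀ g m, ρ g m = m) := by
  let _ := ZMod.algebra K 2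
  let _ := ZMod.algebra F 2
  let ι : K →+* F := (IsAlgClosed.lift (R := ZMod 2) (S := K) (M := F)).toRingHom
  obtain ⟨I, π, hπ⟩ := exists_isMonomialModel ι hK hirred
  by_cases hne : ∃ g m, ρ g m ≠ m
  · left
    have h1 := hπ.finrank_H2_le_one (by omega)
    have h2 := two_le_finrank hne
    omega
  · push Not at hne
    by_cases he2 : e = 2
    · right
      refine ⟨he2, ?_, hne⟩
      obtain ⟨m, hm⟩ := exists_ne (0 : M)
      have hspan : Submodule.span F {m} = ⊤ := (hirred _ fun g x hx => by
        rwa [hne]).resolve_left fun h => hm (Submodule.span_singleton_eq_bot.1 h)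
      rw [← finrank_top, ← hspan, finrank_span_singleton hm]
    · left
      have hI : I = ∅ := by
        by_contra hI
        obtain ⟨m, hm⟩ := (hπ.mem_range_iff (mon ι I)).2 fun a ha => by
          rw [lower_mon, if_neg ha]
        have h0 := congrFun (hπ.map_upper 1 m) 0
        rw [hne, translate_apply, zero_add, hm, mon_zero ι (Finset.nonempty_iff_ne_empty.2 hI)]
          at h0
        simp [mon] at h0
      subst hI
      rw [hπ.finrank_H2_eq_zero (by omega)]
      omega

end FrobeniusMonomial

/-- Let `q = 2ᵉ ≥ 4` and `G = SL(2,q)`.  Let `F` be an algebraically closed field of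
characteristic `r > 0` and `M` a finite-dimensional irreducible `FG`-module.  Then:
(i) if `r ≠ 2`, then `(q-1) · dim H²(G,M) ≤ dim M`;
(ii) if `r = 2`, then `2 · dim H²(G,M) ≤ dim M`, unless `q = 4` and `M` is the
one-dimensional module with trivial `G`-action. -/
theorem stmt_9 (e q r : ℕ) (he : 0 < e) (hq : q = 2 ^ e) (hq4 : 4 ≤ q)
    (K : Type) [Field K] [Fintype K] (hK : Fintype.card K = q)
    (F : Type) [Field F] [IsAlgClosed F] (hr : 0 < r) [CharP F r]
    (M : Type) [AddCommGroup M] [Module F M] [FiniteDimensional F M]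
    (ρ : Representation F (Matrix.SpecialLinearGroup (Fin 2) K) M)
    (hnontrivial : Nontrivial M)
    (hirred : ∀ P : Submodule F M,
      (∀ (g : Matrix.SpecialLinearGroup (Fin 2) K) (x : M), x ∈ P → ρ g x ∈ P) →
        P = ⊥ ∨ P = ⊤) :
    (r ≠ 2 →
      (q - 1) * Module.finrank F (groupCohomology (Rep.of ρ) 2) ≤ Module.finrank F M) ∧
    (r = 2 →
      2 * Module.finrank F (groupCohomology (Rep.of ρ) 2) ≤ Module.finrank F M ∨
        (q = 4 ∧ Module.finrank F M = 1 ∧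
          ∀ (g : Matrix.SpecialLinearGroup (Fin 2) K) (x : M), ρ g x = x)) := by
  have hN : Nat.card K = 2 ^ e := by rw [Nat.card_eq_fintype_card, hK, hq]
  have : CharP K 2 := by
    obtain ⟨p, hp⟩ := CharP.exists K
    have hprime := CharP.char_is_prime K p
    have hzero : ((2 ^ e : ℕ) : K) = 0 := by
      rw [← hq, ← hK]
      exact FiniteField.cast_card_eq_zero K
    rw [CharP.cast_eq_zero_iff K p] at hzero
    rwa [(Nat.prime_dvd_prime_iff_eq hprime Nat.prime_two).1 (hprime.dvd_of_dvd_pow hzero)] at hp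
  refine ⟨fun hr2 => ?_, ?_⟩
  · have hprime : r.Prime := (CharP.char_is_prime_or_zero F r).resolve_right hr.ne'
    have : NeZero (2 : F) := ⟨fun h => hr2 ((Nat.prime_dvd_prime_iff_eq hprime Nat.prime_two).1
      ((CharP.cast_eq_zero_iff F r 2).1 (by exact_mod_cast h)))⟩
    rw [← hK, ← Nat.card_eq_fintype_card]
    exact Matrix.SpecialLinearGroup.cross_characteristic_bound hirred
  · rintro rfl
    have he2 : 2 ≤ e := by
      by_contra h
      have : e = 1 := by omega
      subst this
      omega
    refine (FrobeniusMonomial.defining_characteristic_bound hN he2 hirred).imp_right ?_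
    rintro ⟨rfl, h⟩
    exact ⟨hq, h⟩
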